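/- arXiv:2108.12018 — 11 statements merged into one kernel-verified Lean document; each statement's English description precedes it below -/
import Mathlib

section
/- There exists a minimizer of the signal space uncertainty functional L_S over the normalized domain D_S; that is, there exists f₀ ∈ D_S such that L_S(f₀) ≤ L_S(f) for all f ∈ D_S. -/
open MeasureTheory Set Filter Topology
open scoped ENNReal Topology

noncomputable section

/-- `f` lies in the normalized domain `D_S` of the signal space uncertainty,
with `g` serving as its (a.e.) derivative: `f` is supported in `(0,∞)`,
absolutely continuous on every compact interval (encoded by `f x = ∫₀ˣ g`),
square integrable with `f' ∈ L²((0,∞))` and `ln(ω)·f(ω) ∈ L²((0,∞))`,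
normalized `‖f‖ = 1`, with zero expected time and zero expected scale. -/
def InDS (f g : ℝ → ℂ) : Prop :=
  MemLp f 2 (volume : Measure ℝ) ∧
  (∀ x : ℝ, x ≤ 0 → f x = 0) ∧
  (∀ x : ℝ, IntervalIntegrable g volume 0 x) ∧
  (∀ x : ℝ, f x = ∫ t in (0:ℝ)..x, g t) ∧
  MemLp g 2 (volume.restrict (Set.Ioi (0:ℝ))) ∧
  MemLp (fun ω : ℝ => (Real.log ω : ℂ) * f ω) 2 (volume.restrict (Set.Ioi (0:ℝ))) ∧
  (∫ ω in Set.Ioi (0:ℝ), ‖f ω‖ ^ 2 = 1) ∧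
  (∫ ω in Set.Ioi (0:ℝ), Complex.I * g ω * (starRingEnd ℂ) (f ω) = 0) ∧
  (∫ ω in Set.Ioi (0:ℝ), Real.log ω * ‖f ω‖ ^ 2 = 0)

/-- The signal space uncertainty `L_S(f) = ‖T_x f‖² + ‖T_σ f‖²` of `f ∈ D_S`,
expressed via the derivative `g` of `f`. -/
def LS (f g : ℝ → ℂ) : ℝ :=
  (∫ ω in Set.Ioi (0:ℝ), ‖g ω‖ ^ 2) + ∫ ω in Set.Ioi (0:ℝ), (Real.log ω) ^ 2 * ‖f ω‖ ^ 2


abbrev mu0 : Measure ℝ := volume.restrict (Set.Ioi (0:ℝ))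

lemma weak_seq {H : Type*} [NormedAddCommGroup H] [InnerProductSpace ℂ H] [CompleteSpace H]
    [TopologicalSpace.SeparableSpace H] (u : ℕ → H) (C : ℝ) (h : ∀ n, ‖u n‖ ≤ C) :
    ∃ (v : H) (φ : ℕ → ℕ), StrictMono φ ∧
      ∀ w, Tendsto (fun n => inner ℂ (u (φ n)) w) atTop (𝓝 (inner ℂ v w)) := by
  have hs := WeakDual.isSeqCompact_closedBall ℂ H 0 C
  obtain ⟨a, ha, φ, hφ, hlim⟩ := hs
    (x := fun n => StrongDual.toWeakDual (InnerProductSpace.toDual ℂ H (u n))) (by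
      intro n
      simpa using h n)
  refine ⟨(InnerProductSpace.toDual ℂ H).symm (WeakDual.toStrongDual a), φ, hφ, fun w => ?_⟩
  have := (WeakDual.eval_continuous (𝕜 := ℂ) w).tendsto a |>.comp hlim
  simpa [Function.comp_def] using this

lemma norm_toLp_sq {u : ℝ → ℂ} (hu : MemLp u 2 mu0) :
    ‖hu.toLp u‖ ^ 2 = ∫ x in Ioi (0:ℝ), ‖u x‖ ^ 2 := by
  rw [@norm_sq_eq_re_inner ℂ, L2.inner_def]
  have : ∫ a, inner ℂ (hu.toLp u a) (hu.toLp u a) ∂mu0 = ∫ a, ((‖u a‖ ^ 2 : ℝ) : ℂ) ∂mu0 := by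
    apply integral_congr_ae
    filter_upwards [hu.coeFn_toLp] with x hx
    rw [hx, inner_self_eq_norm_sq_to_K]; simp
  rw [this, integral_complex_ofReal]; simp

lemma eLpNorm_two_eq {u : ℝ → ℂ} (hu : MemLp u 2 mu0) :
    eLpNorm u 2 mu0 = ENNReal.ofReal (√(∫ x in Ioi (0:ℝ), ‖u x‖ ^ 2)) := by
  rw [← norm_toLp_sq hu, Real.sqrt_sq (norm_nonneg _), Lp.norm_toLp, ENNReal.ofReal_toReal hu.2.ne]

lemma fatou_L2 {u : ℕ → ℝ → ℂ} {v : ℝ → ℂ} (hu : ∀ n, MemLp (u n) 2 mu0)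
    (hlim : ∀ x, Tendsto (fun n => u n x) atTop (𝓝 (v x))) {β : ℝ}
    (hβ : Tendsto (fun n => ∫ x in Ioi (0:ℝ), ‖u n x‖ ^ 2) atTop (𝓝 β)) :
    MemLp v 2 mu0 ∧ ∫ x in Ioi (0:ℝ), ‖v x‖ ^ 2 ≤ β := by
  have hm : AEStronglyMeasurable v mu0 :=
    aestronglyMeasurable_of_tendsto_ae atTop (fun n => (hu n).1) (Eventually.of_forall hlim)
  have hβ0 : 0 ≤ β := ge_of_tendsto' hβ fun n => integral_nonneg fun x => by positivity
  have h1 : eLpNorm v 2 mu0 ≤ ENNReal.ofReal (√β) := by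
    refine (Lp.eLpNorm_lim_le_liminf_eLpNorm (fun n => (hu n).1) v
      (Eventually.of_forall hlim)).trans ?_
    have : Tendsto (fun n => eLpNorm (u n) 2 mu0) atTop (𝓝 (ENNReal.ofReal (√β))) := by
      simp_rw [eLpNorm_two_eq (hu _)]
      exact (ENNReal.continuous_ofReal.tendsto _).comp ((Real.continuous_sqrt.tendsto _).comp hβ)
    exact this.liminf_eq.le
  have hv : MemLp v 2 mu0 := ⟨hm, h1.trans_lt ENNReal.ofReal_lt_top⟩
  refine ⟨hv, ?_⟩
  rw [eLpNorm_two_eq hv, ENNReal.ofReal_le_ofReal_iff (Real.sqrt_nonneg _)] at h1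
  exact (Real.sqrt_le_sqrt_iff hβ0).1 h1

/-- truncation of a weight -/
def cut (w : ℝ → ℝ) (R : ℝ) (x : ℝ) : ℝ := if |Real.log x| ≤ R then w x else 0

lemma cut_meas {w : ℝ → ℝ} (hw : Measurable w) (R : ℝ) : Measurable (cut w R) := by
  unfold cut
  exact Measurable.ite (measurableSet_le (by fun_prop) measurable_const) hw measurable_const

lemma weight_integrable {w F : ℝ → ℝ} (hw : Measurable w) (hwb : ∀ x, |w x| ≤ 1 + |Real.log x|)
    (hF0 : ∀ x, 0 ≤ F x) (hFi : Integrable F mu0)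
    (hFl : Integrable (fun x => Real.log x ^ 2 * F x) mu0) :
    Integrable (fun x => w x * F x) mu0 := by
  refine Integrable.mono' ((hFi.const_mul 2).add hFl)
    (hw.aestronglyMeasurable.mul hFi.1) (Eventually.of_forall fun x => ?_)
  simp only [Pi.add_apply, Real.norm_eq_abs, abs_mul, abs_of_nonneg (hF0 x)]
  have h1 := hwb x
  have h2 : |w x| ≤ 2 + Real.log x ^ 2 := by
    nlinarith [sq_nonneg (|Real.log x| - 1), sq_abs (Real.log x), abs_nonneg (Real.log x)]
  nlinarith [hF0 x]

lemma cut_bound {w : ℝ → ℝ} (hwb : ∀ x, |w x| ≤ 1 + |Real.log x|) (R x : ℝ) :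
    |cut w R x| ≤ 1 + |Real.log x| := by
  unfold cut
  split_ifs
  · exact hwb x
  · simp; positivity

lemma tail_bound {w F : ℝ → ℝ} (hw : Measurable w) (hwb : ∀ x, |w x| ≤ 1 + |Real.log x|)
    (hF0 : ∀ x, 0 ≤ F x) (hFi : Integrable F mu0)
    (hFl : Integrable (fun x => Real.log x ^ 2 * F x) mu0) {C : ℝ}
    (hC : ∫ x, Real.log x ^ 2 * F x ∂mu0 ≤ C) {R : ℝ} (hR : 1 ≤ R) :
    |(∫ x, w x * F x ∂mu0) - ∫ x, cut w R x * F x ∂mu0| ≤ 2 / R * C := by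
  have i1 := weight_integrable hw hwb hF0 hFi hFl
  have i2 := weight_integrable (cut_meas hw R) (cut_bound hwb R) hF0 hFi hFl
  rw [← integral_sub i1 i2]
  calc |∫ x, (w x * F x - cut w R x * F x) ∂mu0|
      ≤ ∫ x, |w x * F x - cut w R x * F x| ∂mu0 := abs_integral_le_integral_abs
    _ ≤ ∫ x, 2 / R * (Real.log x ^ 2 * F x) ∂mu0 := by
        refine integral_mono (i1.sub i2).abs (hFl.const_mul _) fun x => ?_
        have hRp : 0 < R := by linarith
        simp only [← sub_mul, abs_mul, abs_of_nonneg (hF0 x)]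
        rw [← mul_assoc]
        refine mul_le_mul_of_nonneg_right ?_ (hF0 x)
        unfold cut
        split_ifs with h
        · simp; positivity
        · push Not at h
          rw [sub_zero, div_mul_eq_mul_div, le_div_iff₀ hRp, ← sq_abs (Real.log x)]
          have := hwb x
          have h2 : |w x| ≤ 2 * |Real.log x| := by linarith
          nlinarith [abs_nonneg (w x), abs_nonneg (Real.log x)]
    _ = 2 / R * ∫ x, Real.log x ^ 2 * F x ∂mu0 := integral_const_mul _ _
    _ ≤ 2 / R * C := by gcongr

lemma tight_tendsto {w : ℝ → ℝ} {F : ℕ → ℝ → ℝ} {G : ℝ → ℝ} (hw : Measurable w)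
    (hwb : ∀ x, |w x| ≤ 1 + |Real.log x|)
    (hF0 : ∀ n x, 0 ≤ F n x) (hFi : ∀ n, Integrable (F n) mu0)
    (hFl : ∀ n, Integrable (fun x => Real.log x ^ 2 * F n x) mu0) {C M : ℝ}
    (hC : ∀ n, ∫ x, Real.log x ^ 2 * F n x ∂mu0 ≤ C)
    (hM : ∀ n x, 0 < x → F n x ≤ M * x)
    (hG0 : ∀ x, 0 ≤ G x) (hGi : Integrable G mu0)
    (hGl : Integrable (fun x => Real.log x ^ 2 * G x) mu0)
    (hGC : ∫ x, Real.log x ^ 2 * G x ∂mu0 ≤ C)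
    (hlim : ∀ x, Tendsto (fun n => F n x) atTop (𝓝 (G x))) :
    Tendsto (fun n => ∫ x, w x * F n x ∂mu0) atTop (𝓝 (∫ x, w x * G x ∂mu0)) := by
  have hM0 : 0 ≤ M := by
    have := (hF0 0 1).trans (hM 0 1 one_pos); linarith
  have hcut : ∀ R : ℝ, 1 ≤ R → Tendsto (fun n => ∫ x, cut w R x * F n x ∂mu0) atTop
      (𝓝 (∫ x, cut w R x * G x ∂mu0)) := by
    intro R hR
    refine tendsto_integral_of_dominated_convergence
      ((Iic (Real.exp R)).indicator fun _ => (1 + R) * (M * Real.exp R)) ?_ ?_ ?_ ?_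
    · intro n
      exact (cut_meas hw R).aestronglyMeasurable.mul (hFi n).1
    · rw [integrable_indicator_iff measurableSet_Iic]
      refine integrableOn_const ?_
      rw [Measure.restrict_apply measurableSet_Iic, Iic_inter_Ioi]
      simp
    · intro n
      filter_upwards [ae_restrict_mem measurableSet_Ioi] with x hx
      have hx0 : 0 < x := hx
      simp only [Real.norm_eq_abs, abs_mul, abs_of_nonneg (hF0 n x)]
      by_cases h : |Real.log x| ≤ R
      · have hxR : x ≤ Real.exp R := by
          rw [← Real.log_le_iff_le_exp hx0]; exact (le_abs_self _).trans h
        rw [indicator_of_mem (show x ∈ Iic (Real.exp R) from hxR)]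
        have := cut_bound hwb R x
        have h2 := hM n x hx0
        refine mul_le_mul (by linarith) (h2.trans (by gcongr)) (hF0 n x) (by linarith)
      · simp only [cut, h, if_false, abs_zero, zero_mul]
        exact indicator_nonneg (fun _ _ => by positivity) _
    · exact Eventually.of_forall fun x => (hlim x).const_mul _
  rw [Metric.tendsto_atTop]
  intro ε hε
  obtain ⟨R, hR1, hR⟩ : ∃ R : ℝ, 1 ≤ R ∧ 2 / R * C < ε / 3 := by
    have h : Tendsto (fun R : ℝ => 2 / R * C) atTop (𝓝 (0 * C)) :=
      (tendsto_const_nhds.div_atTop tendsto_id).mul_const C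
    rw [zero_mul] at h
    exact ((eventually_ge_atTop 1).and (h.eventually (gt_mem_nhds (by positivity)))).exists
  obtain ⟨N, hN⟩ := Metric.tendsto_atTop.1 (hcut R hR1) (ε / 3) (by positivity)
  refine ⟨N, fun n hn => ?_⟩
  have a1 := hN n hn
  have a2 := tail_bound hw hwb (hF0 n) (hFi n) (hFl n) (hC n) hR1
  have a3 := tail_bound hw hwb hG0 hGi hGl hGC hR1
  rw [Real.dist_eq] at a1 ⊢
  rw [abs_lt] at *
  rw [abs_le] at a2 a3
  constructor <;> linarith [a1.1, a1.2, a2.1, a2.2, a3.1, a3.2]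

lemma inDS_of_smooth {p : ℝ → ℝ} (hp : ContDiff ℝ 1 p) {a b : ℝ} (ha : 0 < a)
    (hpz : ∀ x, x ∉ Icc a b → p x = 0)
    (h1 : ∫ x in Ioi (0:ℝ), p x ^ 2 = 1) (h2 : ∫ x in Ioi (0:ℝ), Real.log x * p x ^ 2 = 0) :
    InDS (fun x => (p x : ℂ)) (fun x => ((deriv p x : ℝ) : ℂ)) := by
  have hc : HasCompactSupport p := HasCompactSupport.intro isCompact_Icc hpz
  have hcd : HasCompactSupport (deriv p) := hc.deriv
  have hpc : Continuous p := hp.continuous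
  have hdc : Continuous (deriv p) := hp.continuous_deriv le_rfl
  have hder : ∀ x, HasDerivAt p (deriv p x) x := fun x =>
    (hp.differentiable one_ne_zero x).hasDerivAt
  have hc' : HasCompactSupport (fun x => (p x : ℂ)) :=
    HasCompactSupport.intro (K := Icc a b) isCompact_Icc fun x hx => by simp [hpz x hx]
  have hcd' : HasCompactSupport (fun x => ((deriv p x : ℝ) : ℂ)) :=
    hcd.comp_left (g := fun y : ℝ => (y : ℂ)) (by simp)
  have hp0 : p 0 = 0 := hpz 0 fun h => absurd h.1 (not_le.2 ha)
  have hdc' : Continuous (fun x => ((deriv p x : ℝ) : ℂ)) := by fun_prop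
  refine ⟨?_, ?_, ?_, ?_, ?_, ?_, ?_, ?_, ?_⟩
  · exact Continuous.memLp_of_hasCompactSupport (by fun_prop) hc'
  · intro x hx
    simp [hpz x fun h => absurd h.1 (not_le.2 (hx.trans_lt ha))]
  · intro x
    exact hdc'.intervalIntegrable _ _
  · intro x
    rw [intervalIntegral.integral_ofReal, intervalIntegral.integral_eq_sub_of_hasDerivAt
      (fun y _ => hder y) (hdc.intervalIntegrable _ _), hp0, sub_zero]
  · exact (Continuous.memLp_of_hasCompactSupport hdc' hcd').restrict _
  · refine MemLp.restrict _ (Continuous.memLp_of_hasCompactSupport ?_ ?_)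
    · rw [continuous_iff_continuousAt]
      intro x
      rcases lt_or_ge x a with hx | hx
      · have : (fun ω : ℝ => (Real.log ω : ℂ) * (p ω : ℂ)) =ᶠ[𝓝 x] fun _ => 0 := by
          filter_upwards [Iio_mem_nhds hx] with y hy
          simp [hpz y fun h => absurd h.1 (not_le.2 hy)]
        exact continuousAt_const.congr this.symm
      · have hx0 : x ≠ 0 := (ha.trans_le hx).ne'
        have : ContinuousAt (fun ω : ℝ => (Real.log ω : ℂ)) x :=
          Complex.continuous_ofReal.continuousAt.comp (Real.continuousAt_log hx0)
        exact this.mul (Complex.continuous_ofReal.comp hpc).continuousAt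
    · exact HasCompactSupport.intro (K := Icc a b) isCompact_Icc fun x hx => by simp [hpz x hx]
  · simpa using h1
  · have hz : ∫ x in Ioi (0:ℝ), deriv p x * p x = 0 := by
      have hd : ∀ x ∈ Ici (0:ℝ), HasDerivAt (fun x => p x ^ 2 / 2) (deriv p x * p x) x := by
        intro x _
        have := ((hder x).pow 2).div_const 2
        refine HasDerivAt.congr_deriv (f := fun x => p x ^ 2 / 2) this ?_
        simp only [Nat.cast_ofNat, Nat.add_one_sub_one, pow_one]
        ring
      have ht : Tendsto (fun x => p x ^ 2 / 2) atTop (𝓝 0) := by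
        refine tendsto_const_nhds.congr' ?_
        filter_upwards [eventually_gt_atTop b] with x hx
        simp [hpz x fun h => absurd h.2 (not_le.2 hx)]
      have hi : IntegrableOn (fun x => deriv p x * p x) (Ioi 0) :=
        ((hdc.mul hpc).integrable_of_hasCompactSupport (hc.mul_left)).integrableOn
      rw [integral_Ioi_of_hasDerivAt_of_tendsto' hd hi ht, hp0]; simp
    have : ∀ x, Complex.I * ((deriv p x : ℝ) : ℂ) * (starRingEnd ℂ) (p x : ℂ) =
        Complex.I * ((deriv p x * p x : ℝ) : ℂ) := by
      intro x; simp [mul_assoc]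
    simp_rw [this]
    rw [integral_const_mul, integral_complex_ofReal, hz]; simp
  · simpa using h2

lemma exists_inDS : ∃ f g, InDS f g := by
  let b : ContDiffBump (2:ℝ) := ⟨1/2, 1, by norm_num, by norm_num⟩
  have hbz : ∀ x, x ∉ Icc (1:ℝ) 3 → b x = 0 := by
    intro x hx
    apply b.zero_of_le_dist
    show (1:ℝ) ≤ _
    rw [Real.dist_eq]
    by_contra h
    push Not at h
    rw [abs_lt] at h
    exact hx ⟨by linarith, by linarith⟩
  have hbs : ContDiff ℝ 1 b := b.contDiff
  have hbc : Continuous b := hbs.continuous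
  have hcs : HasCompactSupport b := HasCompactSupport.intro isCompact_Icc hbz
  have hi1 : Integrable (fun x => b x ^ 2) mu0 := by
    refine Integrable.integrableOn (Continuous.integrable_of_hasCompactSupport (by fun_prop) ?_)
    exact HasCompactSupport.intro (K := Icc (1:ℝ) 3) isCompact_Icc fun x hx => by simp [hbz x hx]
  have hi2 : Integrable (fun x => Real.log x * b x ^ 2) mu0 := by
    refine Integrable.mono' (hi1.const_mul (Real.log 3))
      (Measurable.aestronglyMeasurable (by fun_prop)) (Eventually.of_forall fun x => ?_)
    by_cases hx : x ∈ Icc (1:ℝ) 3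
    · rw [norm_mul, Real.norm_eq_abs, Real.norm_eq_abs, abs_of_nonneg (Real.log_nonneg hx.1),
        abs_of_nonneg (sq_nonneg _)]
      have := Real.log_le_log (by linarith [hx.1]) hx.2
      gcongr
    · simp [hbz x hx]
  set N := ∫ x in Ioi (0:ℝ), b x ^ 2 with hN
  set L := ∫ x in Ioi (0:ℝ), Real.log x * b x ^ 2 with hL
  have hNpos : 0 < N := by
    have hcont : Continuous fun x => b x ^ 2 := by fun_prop
    have hsub : N = ∫ x, b x ^ 2 := by
      rw [hN]
      apply setIntegral_eq_integral_of_forall_compl_eq_zero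
      intro x hx
      simp [hbz x fun h => hx (show (0:ℝ) < x by linarith [h.1])]
    rw [hsub]
    refine hcont.integral_pos_of_hasCompactSupport_nonneg_nonzero
      (HasCompactSupport.intro (K := Icc (1:ℝ) 3) isCompact_Icc fun x hx => by simp [hbz x hx])
      (fun x => sq_nonneg _) (x := 2) ?_
    have : b 2 = 1 := b.one_of_mem_closedBall (by simp [b.rIn_pos.le])
    simp [this]
  -- scaling parameter
  set l := Real.exp (L / N) with hl
  have hl0 : 0 < l := Real.exp_pos _
  set c := √(l / N) with hcdef
  have hc2 : c ^ 2 = l / N := Real.sq_sqrt (by positivity)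
  refine ⟨_, _, inDS_of_smooth (p := fun x => c * b (l * x)) (a := 1 / l) (b := 3 / l)
    (by fun_prop) (by positivity) ?_ ?_ ?_⟩
  · intro x hx
    rw [hbz (l * x), mul_zero]
    rintro ⟨h1, h2⟩
    apply hx
    constructor
    · rw [div_le_iff₀ hl0]; linarith
    · rw [le_div_iff₀ hl0]; linarith
  · have := integral_comp_mul_left_Ioi (fun x => b x ^ 2) 0 hl0
    simp_rw [mul_pow]
    rw [integral_const_mul, this, mul_zero, ← hN, hc2, smul_eq_mul]
    field_simp
  · have h3 := integral_comp_mul_left_Ioi (fun x => (Real.log x - L / N) * b x ^ 2) 0 hl0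
    have h4 : ∫ x in Ioi (0:ℝ), (Real.log x - L / N) * b x ^ 2 = 0 := by
      simp_rw [sub_mul]
      rw [integral_sub hi2 (hi1.const_mul _), integral_const_mul, ← hN, ← hL]
      field_simp; simp
    rw [mul_zero, h4, smul_zero] at h3
    have : ∫ x in Ioi (0:ℝ), Real.log x * (c * b (l * x)) ^ 2 =
        ∫ x in Ioi (0:ℝ), c ^ 2 * ((Real.log (l * x) - L / N) * b (l * x) ^ 2) := by
      apply setIntegral_congr_fun measurableSet_Ioi
      intro x hx
      have hx0 : (0:ℝ) < x := hx
      simp only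
      rw [Real.log_mul hl0.ne' hx0.ne', hl, Real.log_exp]; ring
    rw [this, integral_const_mul, h3, mul_zero]

/-- the indicator of `(0,x]` as an element of `L²(0,∞)` -/
def eI (x : ℝ) : Lp ℂ 2 mu0 :=
  indicatorConstLp 2 (measurableSet_Ioc (a := (0:ℝ)) (b := x))
    ((Measure.restrict_apply_le _ _).trans_lt (by simp)).ne (1:ℂ)

lemma integral_eq_inner {k : ℝ → ℂ} (hk : MemLp k 2 mu0) {x : ℝ} (hx : 0 ≤ x) :
    ∫ t in (0:ℝ)..x, k t = inner ℂ (eI x) (hk.toLp k) := by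
  rw [eI, L2.inner_indicatorConstLp_one, intervalIntegral.integral_of_le hx,
    Measure.restrict_restrict measurableSet_Ioc, inter_eq_self_of_subset_left Ioc_subset_Ioi_self]
  apply integral_congr_ae
  have := ae_restrict_of_ae_restrict_of_subset (s := Ioc 0 x) (t := Ioi (0:ℝ))
    Ioc_subset_Ioi_self hk.coeFn_toLp
  filter_upwards [this] with y hy using hy.symm

lemma norm_eI_sq {x : ℝ} (hx : 0 ≤ x) : ‖eI x‖ ^ 2 = x := by
  rw [eI, norm_indicatorConstLp (by simp) (by simp), measureReal_def,
    Measure.restrict_apply measurableSet_Ioc, inter_eq_self_of_subset_left Ioc_subset_Ioi_self]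
  simp [hx]
  rw [← one_div, ← Real.sqrt_eq_rpow, Real.sq_sqrt hx]

lemma integral_sq_le {k : ℝ → ℂ} (hk : MemLp k 2 mu0) {x : ℝ} (hx : 0 ≤ x) {C : ℝ}
    (hC : ∫ x in Ioi (0:ℝ), ‖k x‖ ^ 2 ≤ C) :
    ‖∫ t in (0:ℝ)..x, k t‖ ^ 2 ≤ C * x := by
  rw [integral_eq_inner hk hx]
  have h := norm_inner_le_norm (𝕜 := ℂ) (eI x) (hk.toLp k)
  calc _ ≤ (‖eI x‖ * ‖hk.toLp k‖) ^ 2 := by gcongr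
    _ = x * ∫ x in Ioi (0:ℝ), ‖k x‖ ^ 2 := by rw [mul_pow, norm_eI_sq hx, norm_toLp_sq hk]
    _ ≤ C * x := by rw [mul_comm]; gcongr

lemma integral_I_inner {f g : ℝ → ℂ} (hf : MemLp f 2 mu0) (hg : MemLp g 2 mu0) :
    ∫ ω in Ioi (0:ℝ), Complex.I * g ω * (starRingEnd ℂ) (f ω) =
      Complex.I * inner ℂ (hf.toLp f) (hg.toLp g) := by
  rw [L2.inner_def, ← integral_const_mul]
  apply integral_congr_ae
  filter_upwards [hf.coeFn_toLp, hg.coeFn_toLp] with x h1 h2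
  rw [h1, h2, RCLike.inner_apply, mul_assoc]

lemma log_sq_eq (f : ℝ → ℂ) (x : ℝ) :
    ‖(Real.log x : ℂ) * f x‖ ^ 2 = Real.log x ^ 2 * ‖f x‖ ^ 2 := by
  rw [norm_mul, mul_pow, Complex.norm_real, Real.norm_eq_abs, sq_abs]

lemma limit_step {f g : ℕ → ℝ → ℂ} (h : ∀ n, InDS (f n) (g n))
    (hg : ∀ n, MemLp (g n) 2 mu0) (G : Lp ℂ 2 mu0)
    (hw : ∀ w, Tendsto (fun n => inner ℂ ((hg n).toLp (g n)) w) atTop (𝓝 (inner ℂ G w)))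
    {α β C : ℝ} (hα : Tendsto (fun n => ∫ x in Ioi (0:ℝ), ‖g n x‖ ^ 2) atTop (𝓝 α))
    (hβ : Tendsto (fun n => ∫ x in Ioi (0:ℝ), Real.log x ^ 2 * ‖f n x‖ ^ 2) atTop (𝓝 β))
    (hCα : ∀ n, ∫ x in Ioi (0:ℝ), ‖g n x‖ ^ 2 ≤ C)
    (hCβ : ∀ n, ∫ x in Ioi (0:ℝ), Real.log x ^ 2 * ‖f n x‖ ^ 2 ≤ C) :
    ∃ f₀ g₀, InDS f₀ g₀ ∧ LS f₀ g₀ ≤ α + β := by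
  have hw' : ∀ w, Tendsto (fun n => inner ℂ w ((hg n).toLp (g n))) atTop (𝓝 (inner ℂ w G)) := by
    intro w
    have := (Complex.continuous_conj.tendsto _).comp (hw w)
    simpa [Function.comp_def, inner_conj_symm] using this
  set g₀ : ℝ → ℂ := (Ioi (0:ℝ)).indicator G with hg₀
  have hae : g₀ =ᵐ[mu0] G := indicator_ae_eq_restrict measurableSet_Ioi
  have hg₀m : MemLp g₀ 2 mu0 := (memLp_congr_ae hae).2 (Lp.memLp G)
  have hg₀v : MemLp g₀ 2 volume := by
    rw [hg₀, memLp_indicator_iff_restrict measurableSet_Ioi]; exact Lp.memLp G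
  have htoLp : hg₀m.toLp g₀ = G := by
    apply Lp.ext
    exact hg₀m.coeFn_toLp.trans hae
  set f₀ : ℝ → ℂ := fun x => ∫ t in (0:ℝ)..x, g₀ t with hf₀
  have hgi : ∀ x, IntervalIntegrable g₀ volume 0 x := by
    intro x
    have := hg₀v.locallyIntegrable (by norm_num)
    exact (this.integrableOn_isCompact isCompact_uIcc).intervalIntegrable
  have hneg : ∀ x ≤ 0, f₀ x = 0 := by
    intro x hx
    simp only [hf₀]
    rw [intervalIntegral.integral_of_ge hx, setIntegral_eq_zero_of_forall_eq_zero, neg_zero]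
    intro y hy
    exact indicator_of_notMem (fun h => absurd h (not_lt.2 hy.2)) _
  have hlim : ∀ x, Tendsto (fun n => f n x) atTop (𝓝 (f₀ x)) := by
    intro x
    rcases le_total x 0 with hx | hx
    · rw [hneg x hx]
      refine tendsto_const_nhds.congr fun n => ((h n).2.1 x hx).symm
    · have := hw' (eI x)
      rw [← htoLp, ← integral_eq_inner hg₀m hx] at this
      refine this.congr fun n => ?_
      rw [← integral_eq_inner (hg n) hx]
      exact ((h n).2.2.2.1 x).symm
  have hfm : ∀ n, MemLp (f n) 2 mu0 := fun n => (h n).1.restrict _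
  have hnorm : ∀ n, ∫ x in Ioi (0:ℝ), ‖f n x‖ ^ 2 = 1 := fun n => (h n).2.2.2.2.2.2.1
  have hlm : ∀ n, MemLp (fun ω : ℝ => (Real.log ω : ℂ) * f n ω) 2 mu0 :=
    fun n => (h n).2.2.2.2.2.1
  obtain ⟨hf₀m, -⟩ := fatou_L2 (β := 1) hfm hlim (by simp_rw [hnorm]; exact tendsto_const_nhds)
  obtain ⟨hl₀m, hl₀β⟩ := fatou_L2 (v := fun ω : ℝ => (Real.log ω : ℂ) * f₀ ω) (β := β) hlm
    (fun x => (hlim x).const_mul _) (by simp_rw [log_sq_eq]; exact hβ)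
  simp_rw [log_sq_eq] at hl₀β
  have hβC : β ≤ C := le_of_tendsto' hβ hCβ
  have hαC : α ≤ C := le_of_tendsto' hα hCα
  -- lower semicontinuity for g
  have hgα : ∫ x in Ioi (0:ℝ), ‖g₀ x‖ ^ 2 ≤ α := by
    rw [← norm_toLp_sq hg₀m, htoLp]
    have hα0 : 0 ≤ α := ge_of_tendsto' hα fun n => integral_nonneg fun x => by positivity
    have h1 : Tendsto (fun n => ‖inner ℂ ((hg n).toLp (g n)) G‖) atTop (𝓝 ‖inner ℂ G G‖) :=
      (hw G).norm
    have h2 : Tendsto (fun n => ‖(hg n).toLp (g n)‖ * ‖G‖) atTop (𝓝 (√α * ‖G‖)) := by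
      refine Tendsto.mul_const _ ?_
      have := (Real.continuous_sqrt.tendsto _).comp hα
      refine this.congr fun n => ?_
      simp only [Function.comp]
      rw [← norm_toLp_sq (hg n), Real.sqrt_sq (norm_nonneg _)]
    have h3 := le_of_tendsto_of_tendsto' h1 h2 fun n => norm_inner_le_norm _ _
    rw [inner_self_eq_norm_sq_to_K] at h3
    simp only [norm_pow, RCLike.norm_ofReal, abs_norm] at h3
    have hs := Real.sq_sqrt hα0
    have hs0 := Real.sqrt_nonneg α
    rcases (norm_nonneg G).eq_or_lt with h0 | h0
    · rw [← h0]; simpa using hα0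
    · have : ‖G‖ ≤ √α := by
        by_contra hcon
        push Not at hcon
        nlinarith
      nlinarith
  have hfi : ∀ n, Integrable (fun x => ‖f n x‖ ^ 2) mu0 := fun n => (memLp_two_iff_integrable_sq_norm (hfm n).1).1 (hfm n)
  have hf₀i : Integrable (fun x => ‖f₀ x‖ ^ 2) mu0 := (memLp_two_iff_integrable_sq_norm hf₀m.1).1 hf₀m
  have hli : ∀ n, Integrable (fun x => Real.log x ^ 2 * ‖f n x‖ ^ 2) mu0 := fun n => by
    simpa only [log_sq_eq] using (memLp_two_iff_integrable_sq_norm (hlm n).1).1 (hlm n)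
  have hl₀i : Integrable (fun x => Real.log x ^ 2 * ‖f₀ x‖ ^ 2) mu0 := by
    simpa only [log_sq_eq] using (memLp_two_iff_integrable_sq_norm hl₀m.1).1 hl₀m
  have hbd : ∀ n x, 0 < x → ‖f n x‖ ^ 2 ≤ C * x := by
    intro n x hx
    rw [(h n).2.2.2.1 x]
    exact integral_sq_le (hg n) hx.le (hCα n)
  have hbd₀ : ∀ x, 0 < x → ‖f₀ x‖ ^ 2 ≤ C * x := by
    intro x hx
    exact integral_sq_le hg₀m hx.le (hgα.trans hαC)
  have hlim2 : ∀ x, Tendsto (fun n => ‖f n x‖ ^ 2) atTop (𝓝 (‖f₀ x‖ ^ 2)) :=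
    fun x => (hlim x).norm.pow 2
  have T : ∀ w : ℝ → ℝ, Measurable w → (∀ x, |w x| ≤ 1 + |Real.log x|) →
      Tendsto (fun n => ∫ x, w x * ‖f n x‖ ^ 2 ∂mu0) atTop (𝓝 (∫ x, w x * ‖f₀ x‖ ^ 2 ∂mu0)) :=
    fun w hwm hwb => tight_tendsto hwm hwb (fun _ _ => by positivity) hfi hli hCβ hbd
      (fun _ => by positivity) hf₀i hl₀i (hl₀β.trans hβC) hlim2
  have c1 : ∫ x in Ioi (0:ℝ), ‖f₀ x‖ ^ 2 = 1 := by
    have := T (fun _ => 1) measurable_const (fun x => by simp)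
    simp only [one_mul, hnorm] at this
    exact tendsto_nhds_unique this tendsto_const_nhds
  have c2 : ∫ x in Ioi (0:ℝ), Real.log x * ‖f₀ x‖ ^ 2 = 0 := by
    have := T Real.log Real.measurable_log (fun x => by linarith)
    have hz : ∀ n, ∫ x in Ioi (0:ℝ), Real.log x * ‖f n x‖ ^ 2 = 0 :=
      fun n => (h n).2.2.2.2.2.2.2.2
    simp only [hz] at this
    exact tendsto_nhds_unique this tendsto_const_nhds
  -- strong convergence
  have hsq : ∀ (n : ℕ) (x : ℝ), ‖f₀ x - f n x‖ ^ 2 ≤ 2 * ‖f₀ x‖ ^ 2 + 2 * ‖f n x‖ ^ 2 := by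
    intro n x
    have := norm_sub_le (f₀ x) (f n x)
    nlinarith [norm_nonneg (f₀ x - f n x), sq_nonneg (‖f₀ x‖ - ‖f n x‖)]
  have hdm : ∀ n, MemLp (fun x => f₀ x - f n x) 2 mu0 := fun n => hf₀m.sub (hfm n)
  have hlsq : ∀ (n : ℕ) (x : ℝ), Real.log x ^ 2 * ‖f₀ x - f n x‖ ^ 2 ≤
      2 * (Real.log x ^ 2 * ‖f₀ x‖ ^ 2) + 2 * (Real.log x ^ 2 * ‖f n x‖ ^ 2) := by
    intro n x
    have := mul_le_mul_of_nonneg_left (hsq n x) (sq_nonneg (Real.log x))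
    linarith
  have hdl : ∀ n, Integrable (fun x => Real.log x ^ 2 * ‖f₀ x - f n x‖ ^ 2) mu0 := by
    intro n
    refine Integrable.mono' ((hl₀i.const_mul 2).add ((hli n).const_mul 2))
      ((Real.measurable_log.pow_const 2).aestronglyMeasurable.mul ((hdm n).1.norm.pow 2))
      (Eventually.of_forall fun x => ?_)
    rw [Real.norm_of_nonneg (by positivity)]
    exact hlsq n x
  have hstrong : Tendsto (fun n => ∫ x in Ioi (0:ℝ), ‖f₀ x - f n x‖ ^ 2) atTop (𝓝 0) := by
    have C0 : 0 ≤ C := le_trans (integral_nonneg fun x => by positivity) (hCα 0)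
    have := tight_tendsto (w := fun _ => 1) (F := fun n x => ‖f₀ x - f n x‖ ^ 2) (G := fun _ => 0)
      (C := 4 * C) (M := 4 * C)
      measurable_const (fun x => by simp) (fun _ _ => by positivity)
      (fun n => (memLp_two_iff_integrable_sq_norm (hdm n).1).1 (hdm n)) hdl ?_ ?_ (fun _ => le_rfl)
      (by simp) (by simp) (by simpa using C0) ?_
    · simpa using this
    · intro n
      have := integral_mono (hdl n) ((hl₀i.const_mul 2).add ((hli n).const_mul 2)) (hlsq n)
      refine this.trans ?_
      simp only [Pi.add_apply]
      rw [integral_add (hl₀i.const_mul 2) ((hli n).const_mul 2), integral_const_mul,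
        integral_const_mul]
      linarith [hCβ n]
    · intro n x hx
      linarith [hsq n x, hbd n x hx, hbd₀ x hx]
    · intro x
      have := ((hlim x).const_sub (f₀ x)).norm.pow 2
      simpa using this
  have c3 : inner ℂ (hf₀m.toLp f₀) G = 0 := by
    refine tendsto_nhds_unique (hw' (hf₀m.toLp f₀)) ?_
    have hz : ∀ n, inner ℂ ((hfm n).toLp (f n)) ((hg n).toLp (g n)) = 0 := by
      intro n
      have := (h n).2.2.2.2.2.2.2.1
      rw [integral_I_inner (hfm n) (hg n)] at this
      simpa using this
    have hb : ∀ n, ‖inner ℂ (hf₀m.toLp f₀) ((hg n).toLp (g n))‖ ≤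
        √(∫ x in Ioi (0:ℝ), ‖f₀ x - f n x‖ ^ 2) * √C := by
      intro n
      have e1 : inner ℂ (hf₀m.toLp f₀) ((hg n).toLp (g n)) =
          inner ℂ ((hdm n).toLp _) ((hg n).toLp (g n)) := by
        have : (hdm n).toLp _ = hf₀m.toLp f₀ - (hfm n).toLp (f n) := MemLp.toLp_sub hf₀m (hfm n)
        rw [this, inner_sub_left, hz n, sub_zero]
      rw [e1]
      refine (norm_inner_le_norm _ _).trans ?_
      refine mul_le_mul ?_ ?_ (norm_nonneg _) (Real.sqrt_nonneg _)
      · rw [← norm_toLp_sq (hdm n), Real.sqrt_sq (norm_nonneg _)]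
      · apply Real.le_sqrt_of_sq_le
        rw [norm_toLp_sq (hg n)]; exact hCα n
    refine squeeze_zero_norm hb ?_
    have := ((Real.continuous_sqrt.tendsto _).comp hstrong).mul_const (√C)
    simpa [Function.comp_def] using this
  refine ⟨f₀, g₀, ⟨?_, hneg, hgi, fun x => rfl, hg₀m, hl₀m, c1, ?_, c2⟩, ?_⟩
  · have : f₀ = (Ioi (0:ℝ)).indicator f₀ := by
      ext x
      by_cases hx : x ∈ Ioi (0:ℝ)
      · rw [indicator_of_mem hx]
      · rw [indicator_of_notMem hx, hneg x (not_lt.1 hx)]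
    rw [this, memLp_indicator_iff_restrict measurableSet_Ioi]
    exact hf₀m
  · rw [integral_I_inner hf₀m hg₀m, htoLp, c3, mul_zero]
  · exact add_le_add hgα hl₀β

/-- There exists a minimizer of the signal space uncertainty `L_S` over `D_S`. -/
theorem exists_minimizer_LS :
    ∃ f₀ g₀ : ℝ → ℂ, InDS f₀ g₀ ∧ ∀ f g : ℝ → ℂ, InDS f g → LS f₀ g₀ ≤ LS f g := by
  set S : Set ℝ := {r | ∃ f g, InDS f g ∧ LS f g = r} with hS
  have hne : S.Nonempty := by
    obtain ⟨f, g, h⟩ := exists_inDS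
    exact ⟨_, f, g, h, rfl⟩
  have hA : ∀ g : ℝ → ℂ, 0 ≤ ∫ x in Ioi (0:ℝ), ‖g x‖ ^ 2 :=
    fun g => integral_nonneg fun x => by positivity
  have hB : ∀ f : ℝ → ℂ, 0 ≤ ∫ x in Ioi (0:ℝ), Real.log x ^ 2 * ‖f x‖ ^ 2 :=
    fun g => integral_nonneg fun x => by positivity
  have hbdd : BddBelow S := by
    refine ⟨0, ?_⟩
    rintro r ⟨f, g, -, rfl⟩
    exact add_nonneg (hA g) (hB f)
  obtain ⟨u, -, hu, huS⟩ := exists_seq_tendsto_sInf hne hbdd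
  choose f g hfg hLS using huS
  obtain ⟨C, hC⟩ := hu.bddAbove_range
  have hC' : ∀ n, LS (f n) (g n) ≤ C := fun n => by rw [hLS]; exact hC ⟨n, rfl⟩
  have hCα : ∀ n, ∫ x in Ioi (0:ℝ), ‖g n x‖ ^ 2 ≤ C := fun n => by
    have := hC' n; unfold LS at this; linarith [hB (f n)]
  have hCβ : ∀ n, ∫ x in Ioi (0:ℝ), Real.log x ^ 2 * ‖f n x‖ ^ 2 ≤ C := fun n => by
    have := hC' n; unfold LS at this; linarith [hA (g n)]
  have hg : ∀ n, MemLp (g n) 2 mu0 := fun n => (hfg n).2.2.2.2.1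
  have : Fact ((2:ℝ≥0∞) ≠ ∞) := ⟨by simp⟩
  obtain ⟨G, φ, hφ, hw⟩ := weak_seq (fun n => (hg n).toLp (g n)) (√C) (fun n => by
    apply Real.le_sqrt_of_sq_le
    rw [norm_toLp_sq (hg n)]; exact hCα n)
  obtain ⟨α, -, ψ, hψ, hα⟩ := (isCompact_Icc (a := (0:ℝ)) (b := C)).tendsto_subseq
    (x := fun n => ∫ x in Ioi (0:ℝ), ‖g (φ n) x‖ ^ 2) (fun n => ⟨hA _, hCα _⟩)
  have hα' : Tendsto (fun n => ∫ x in Ioi (0:ℝ), ‖g (φ (ψ n)) x‖ ^ 2) atTop (𝓝 α) := hα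
  have hβ : Tendsto (fun n => ∫ x in Ioi (0:ℝ), Real.log x ^ 2 * ‖f (φ (ψ n)) x‖ ^ 2) atTop
      (𝓝 (sInf S - α)) := by
    have := ((hu.comp hφ.tendsto_atTop).comp hψ.tendsto_atTop).sub hα'
    refine this.congr fun n => ?_
    simp only [Function.comp]
    rw [← hLS]; unfold LS; ring
  obtain ⟨f₀, g₀, h₀, hle⟩ := limit_step (fun n => hfg (φ (ψ n))) (fun n => hg (φ (ψ n))) G
    (fun w => (hw w).comp hψ.tendsto_atTop) hα' hβ (fun n => hCα _) (fun n => hCβ _)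
  refine ⟨f₀, g₀, h₀, fun f g h => ?_⟩
  have : sInf S ≤ LS f g := csInf_le hbdd ⟨f, g, h, rfl⟩
  linarith
end
end

section
/- Every f ∈ L²((0,∞)) that is absolutely continuous on every compact interval of ℝ (so f(0)=0) and whose derivative f' lies in L²((0,∞)) is admissible, i.e., satisfies ∫₀^∞ |f(ω)|²/ω dω < ∞. -/
open MeasureTheory Set Filter Topology
open scoped ENNReal Topology

noncomputable section

theorem norm_sq_div_le_aux (f g : ℝ → ℂ)
    (hfg : ∀ x : ℝ, f x = ∫ t in (0:ℝ)..x, g t)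
    (hg : MemLp g 2 (volume.restrict (Set.Ioi (0:ℝ)))) (x : ℝ) (hx : 0 < x) :
    ‖f x‖ ^ 2 / x ≤ (eLpNorm g 2 (volume.restrict (Set.Ioi (0:ℝ)))).toReal ^ 2 := by
  have hmono : volume.restrict (Ioc 0 x) ≤ volume.restrict (Ioi (0:ℝ)) :=
    Measure.restrict_mono Ioc_subset_Ioi_self le_rfl
  have h1 : ‖f x‖ₑ ≤ eLpNorm g 1 (volume.restrict (Ioc 0 x)) := by
    rw [hfg, intervalIntegral.integral_of_le hx.le, eLpNorm_one_eq_lintegral_enorm]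
    exact enorm_integral_le_lintegral_enorm _
  have h2 := eLpNorm_le_eLpNorm_mul_rpow_measure_univ (p := 1) (q := 2) (by norm_num)
    (hg.1.mono_measure hmono)
  have h3 : eLpNorm g 2 (volume.restrict (Ioc 0 x)) ≤
      eLpNorm g 2 (volume.restrict (Ioi (0:ℝ))) := eLpNorm_mono_measure g hmono
  have h4 : ‖f x‖ₑ ≤ eLpNorm g 2 (volume.restrict (Ioi (0:ℝ))) *
      ENNReal.ofReal x ^ (1 / 2 : ℝ) := by
    refine h1.trans (h2.trans ?_)
    have e : (1 / (1:ℝ≥0∞).toReal - 1 / (2:ℝ≥0∞).toReal) = (1 / 2 : ℝ) := by norm_num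
    rw [e, Measure.restrict_apply_univ, Real.volume_Ioc, sub_zero]
    gcongr
  have h5 := ENNReal.toReal_mono (ENNReal.mul_ne_top hg.2.ne (by simp)) h4
  rw [ENNReal.toReal_mul, ← ENNReal.toReal_rpow, ENNReal.toReal_ofReal hx.le, toReal_enorm,
    ← Real.sqrt_eq_rpow] at h5
  rw [div_le_iff₀ hx]
  calc ‖f x‖ ^ 2 ≤ _ := pow_le_pow_left₀ (norm_nonneg _) h5 2
    _ = _ := by rw [mul_pow, Real.sq_sqrt hx.le]

/-- Every `f ∈ L²((0,∞))` that is absolutely continuous on every compact interval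
(encoded by `f x = ∫₀ˣ g` with `g` locally interval integrable, so in particular
`f 0 = 0`) and whose derivative `g` lies in `L²((0,∞))` is admissible:
`∫₀^∞ |f(ω)|²/ω dω < ∞`. -/
theorem admissible_of_memDomLS (f g : ℝ → ℂ)
    (hf : MemLp f 2 (volume : Measure ℝ))
    (hsupp : ∀ x : ℝ, x ≤ 0 → f x = 0)
    (hgint : ∀ x : ℝ, IntervalIntegrable g volume 0 x)
    (hfg : ∀ x : ℝ, f x = ∫ t in (0:ℝ)..x, g t)
    (hg : MemLp g 2 (volume.restrict (Set.Ioi (0:ℝ)))) :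
    ∫⁻ ω in Set.Ioi (0:ℝ), ENNReal.ofReal (‖f ω‖ ^ 2 / ω) < ⊤ := by
  have hI : Integrable (fun x => ‖f x‖ ^ 2) volume := by
    simpa using hf.integrable_norm_pow (by norm_num)
  rw [← Ioc_union_Ioi_eq_Ioi (zero_le_one' ℝ)]
  refine (lintegral_union_le _ _ _).trans_lt (ENNReal.add_lt_top.2 ⟨?_, ?_⟩)
  · refine (setLIntegral_mono measurable_const (fun x hx => ENNReal.ofReal_le_ofReal
      (norm_sq_div_le_aux f g hfg hg x hx.1))).trans_lt ?_
    rw [setLIntegral_const, Real.volume_Ioc]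
    exact ENNReal.mul_lt_top ENNReal.ofReal_lt_top ENNReal.ofReal_lt_top
  · refine lt_of_le_of_lt ?_ hI.lintegral_lt_top
    refine (setLIntegral_mono' measurableSet_Ioi (fun x hx => ENNReal.ofReal_le_ofReal
      (div_le_self (by positivity) (le_of_lt hx)))).trans (setLIntegral_le_lintegral _ _)
end
end

section
/- For any M ≥ 0, the set A = { f ∈ L²((0,∞)) : f is absolutely continuous on every compact interval of ℝ, f' ∈ L²((0,∞)), ∫₀^∞ |f'(ω)|² dω ≤ M, and ∫₀^∞ i f'(ω)·conj(f(ω)) dω = 0 } is closed in L²((0,∞)). -/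
open MeasureTheory Set Filter Topology
open scoped ENNReal Topology

noncomputable section

/-- Weak compactness of balls in a Hilbert space, along an ultrafilter. -/
theorem exists_weak_limit {H : Type*} [NormedAddCommGroup H] [InnerProductSpace ℂ H]
    [CompleteSpace H] (U : Ultrafilter ℕ) (G : ℕ → H) (r : ℝ) (hG : ∀ n, ‖G n‖ ≤ r) :
    ∃ G' : H, ‖G'‖ ≤ r ∧
      ∀ h : H, Tendsto (fun n => inner ℂ h (G n)) (U : Filter ℕ) (𝓝 (inner ℂ h G')) := by
  have hc := WeakDual.isCompact_closedBall (𝕜 := ℂ) (E := H) 0 r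
  let T : ℕ → WeakDual ℂ H := fun n => StrongDual.toWeakDual (InnerProductSpace.toDual ℂ H (G n))
  have hT : ∀ n, T n ∈ WeakDual.toStrongDual ⁻¹' Metric.closedBall (0 : StrongDual ℂ H) r := by
    intro n
    have : ‖InnerProductSpace.toDual ℂ H (G n)‖ ≤ r := by
      rw [LinearIsometryEquiv.norm_map]; exact hG n
    exact mem_closedBall_zero_iff.2 this
  obtain ⟨l, hl, hle⟩ := hc.ultrafilter_le_nhds (U.map T) (by
    rw [le_principal_iff]
    exact Ultrafilter.mem_map.2 (Filter.Eventually.of_forall hT))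
  have hl' : ‖WeakDual.toStrongDual l‖ ≤ r := mem_closedBall_zero_iff.1 hl
  refine ⟨(InnerProductSpace.toDual ℂ H).symm (WeakDual.toStrongDual l), ?_, ?_⟩
  · rw [LinearIsometryEquiv.norm_map]; exact hl'
  · intro h
    have h1 : Tendsto T (U : Filter ℕ) (𝓝 l) := hle
    have h2 := (WeakDual.eval_continuous (𝕜 := ℂ) h).continuousAt.tendsto.comp h1
    have h3 := (Complex.continuous_conj.tendsto _).comp h2
    have e1 : inner ℂ h ((InnerProductSpace.toDual ℂ H).symm (WeakDual.toStrongDual l))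
        = (starRingEnd ℂ) (l h) := by
      rw [← inner_conj_symm, InnerProductSpace.toDual_symm_apply]; rfl
    rw [e1]
    refine h3.congr fun n => ?_
    rw [← inner_conj_symm h (G n)]; rfl

/-- The squared norm of an L2 function as an integral. -/
theorem norm_sq_L2 {μ : Measure ℝ} (G : Lp ℂ 2 μ) : ‖G‖ ^ 2 = ∫ x, ‖G x‖ ^ 2 ∂μ := by
  have h : (inner ℂ G G : ℂ) = ∫ x, inner ℂ (G x) (G x) ∂μ := L2.inner_def G G
  simp_rw [inner_self_eq_norm_sq_to_K] at h
  exact_mod_cast h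

theorem interval_eq_inner (G : Lp ℂ 2 (volume.restrict (Ioi (0:ℝ)))) (g : ℝ → ℂ)
    (hg : G =ᵐ[volume.restrict (Ioi (0:ℝ))] g) (x : ℝ) (hx : 0 ≤ x)
    (hfin : (volume.restrict (Ioi (0:ℝ))) (Ioc 0 x) ≠ ∞) :
    ∫ t in (0:ℝ)..x, g t =
      inner ℂ (indicatorConstLp 2 (measurableSet_Ioc (a := (0:ℝ)) (b := x)) hfin (1 : ℂ)) G := by
  have hsub : Ioc 0 x ⊆ Ioi (0:ℝ) := fun t ht => ht.1
  rw [L2.inner_indicatorConstLp_one, intervalIntegral.integral_of_le hx,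
    Measure.restrict_restrict measurableSet_Ioc,
    inter_eq_left.2 hsub]
  exact integral_congr_ae (ae_restrict_of_ae_restrict_of_subset hsub hg.symm)

theorem isClosed_setA (M : ℝ) (hM : 0 ≤ M) :
    IsClosed {F : Lp ℂ 2 (volume : Measure ℝ) |
      ∃ f g : ℝ → ℂ, (⇑F =ᵐ[volume] f) ∧
        (∀ x : ℝ, x ≤ 0 → f x = 0) ∧
        (∀ x : ℝ, IntervalIntegrable g volume 0 x) ∧
        (∀ x : ℝ, f x = ∫ t in (0:ℝ)..x, g t) ∧
        MemLp g 2 (volume.restrict (Set.Ioi (0:ℝ))) ∧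
        (∫ ω in Set.Ioi (0:ℝ), ‖g ω‖ ^ 2 ≤ M) ∧
        (∫ ω in Set.Ioi (0:ℝ), Complex.I * g ω * (starRingEnd ℂ) (f ω) = 0)} := by
  apply IsSeqClosed.isClosed
  intro F₀ F hF₀ hlim₀
  obtain ⟨φ, hφ, hae⟩ := (tendstoInMeasure_of_tendsto_Lp hlim₀).exists_seq_tendsto_ae
  have hlim : Tendsto (fun n => F₀ (φ n)) atTop (𝓝 F) := hlim₀.comp hφ.tendsto_atTop
  choose f g hFf hf0 hgi hfg hgL hgM hgf using fun n => hF₀ (φ n)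
  set μ : Measure ℝ := volume.restrict (Ioi (0:ℝ)) with hμ
  let G : ℕ → Lp ℂ 2 μ := fun n => (hgL n).toLp (g n)
  have hGg : ∀ n, G n =ᵐ[μ] g n := fun n => (hgL n).coeFn_toLp
  have hGn : ∀ n, ‖G n‖ ≤ √M := by
    intro n
    apply Real.le_sqrt_of_sq_le
    rw [norm_sq_L2]
    refine le_trans (le_of_eq (integral_congr_ae ?_)) (hgM n)
    filter_upwards [hGg n] with x hx
    rw [hx]
  let U : Ultrafilter ℕ := hyperfilter ℕ
  have hU : (U : Filter ℕ) ≤ atTop := by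
    rw [← Nat.cofinite_eq_atTop]; exact hyperfilter_le_cofinite
  obtain ⟨G', hG'n, hG'⟩ := exists_weak_limit U G (√M) hGn
  let g' : ℝ → ℂ := (Ioi (0:ℝ)).indicator G'
  have hg'G : G' =ᵐ[μ] g' := by
    filter_upwards [ae_restrict_mem measurableSet_Ioi] with x hx
    exact (indicator_of_mem hx _).symm
  have hg'L : MemLp g' 2 μ := (memLp_congr_ae hg'G).1 (Lp.memLp G')
  let f' : ℝ → ℂ := fun x => ∫ t in (0:ℝ)..x, g' t
  have hf'0 : ∀ x ≤ 0, f' x = 0 := by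
    intro x hx
    have : ∀ t ∈ uIoc 0 x, g' t = 0 := by
      intro t ht
      rw [uIoc_of_ge hx] at ht
      exact indicator_of_notMem (by simpa using ht.2) _
    exact (intervalIntegral.integral_congr_ae (g := fun _ => 0)
      (Eventually.of_forall this)).trans (by simp)
  have hfin : ∀ x : ℝ, μ (Ioc 0 x) ≠ ∞ := fun x =>
    ((Measure.restrict_apply_le _ _).trans_lt measure_Ioc_lt_top).ne
  have hpt : ∀ x, Tendsto (fun n => f n x) (U : Filter ℕ) (𝓝 (f' x)) := by
    intro x
    rcases le_total x 0 with hx | hx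
    · rw [hf'0 x hx]
      exact tendsto_const_nhds.congr fun n => (hf0 n x hx).symm
    · have e : f' x = _ := interval_eq_inner G' g' hg'G x hx (hfin x)
      rw [e]
      refine (hG' _).congr fun n => ?_
      rw [hfg n x, interval_eq_inner (G n) (g n) (hGg n) x hx (hfin x)]
  have hFf' : F =ᵐ[volume] f' := by
    filter_upwards [hae, ae_all_iff.2 hFf] with x hx hx2
    refine tendsto_nhds_unique (hx.mono_left hU) ((hpt x).congr fun n => (hx2 n).symm)
  -- restrictions to the half line
  let R := LpToLpRestrictCLM ℝ ℂ ℂ (volume : Measure ℝ) 2 (Ioi (0:ℝ))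
  have hR : Tendsto (fun n => R (F₀ (φ n))) (U : Filter ℕ) (𝓝 (R F)) :=
    ((R.continuous.tendsto F).comp hlim).mono_left hU
  have key : ∀ (K : Lp ℂ 2 (volume : Measure ℝ)) (L : Lp ℂ 2 μ) (k l : ℝ → ℂ),
      K =ᵐ[volume] k → L =ᵐ[μ] l →
      ∫ ω in Ioi (0:ℝ), Complex.I * l ω * (starRingEnd ℂ) (k ω) = Complex.I * inner ℂ (R K) L := by
    intro K L k l hK hL
    rw [L2.inner_def, ← integral_const_mul]
    refine integral_congr_ae ?_
    filter_upwards [ae_restrict_of_ae hK, hL, LpToLpRestrictCLM_coeFn ℂ (Ioi (0:ℝ)) K]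
      with x h1 h2 h3
    have h3' : (R K) x = K x := h3
    rw [h3', h1, h2, RCLike.inner_apply, mul_assoc]
  have hz : ∀ n, inner ℂ (R (F₀ (φ n))) (G n) = 0 := by
    intro n
    have := key _ _ _ _ (hFf n) (hGg n)
    rw [hgf n] at this
    simpa using this.symm
  have hinner : inner ℂ (R F) G' = 0 := by
    refine tendsto_nhds_unique (hG' (R F)) ?_
    have hd : Tendsto (fun n => ‖R F - R (F₀ (φ n))‖ * √M) (U : Filter ℕ) (𝓝 0) := by
      have := ((tendsto_const_nhds (x := R F)).sub hR).norm.mul_const (√M)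
      simpa using this
    refine squeeze_zero_norm (fun n => ?_) hd
    have : inner ℂ (R F) (G n) = inner ℂ (R F - R (F₀ (φ n))) (G n) := by
      rw [inner_sub_left, hz n, sub_zero]
    rw [this]
    exact (norm_inner_le_norm _ _).trans (mul_le_mul_of_nonneg_left (hGn n) (norm_nonneg _))
  refine ⟨f', g', hFf', hf'0, ?_, fun x => rfl, hg'L, ?_, ?_⟩
  · intro x
    have hL : MemLp g' 2 volume := (memLp_indicator_iff_restrict measurableSet_Ioi).2 (Lp.memLp G')
    have hloc : LocallyIntegrable g' volume := hL.locallyIntegrable (by norm_num)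
    exact (hloc.integrableOn_isCompact isCompact_uIcc).intervalIntegrable
  · have h1 : ‖G'‖ ^ 2 ≤ M := by
      calc ‖G'‖ ^ 2 ≤ (√M) ^ 2 := by gcongr
        _ = M := Real.sq_sqrt hM
    rw [norm_sq_L2] at h1
    refine le_trans (le_of_eq (integral_congr_ae ?_)) h1
    filter_upwards [hg'G] with x hx
    rw [hx]
  · rw [key F G' f' g' hFf' hg'G, hinner, mul_zero]
end
end

section
/- For any K > 0, the set K_S = { f ∈ L²((0,∞)) : f absolutely continuous on every compact interval of ℝ, f' ∈ L²((0,∞)), ω ↦ ln(ω)f(ω) ∈ L²((0,∞)), ‖f‖_{L²} = 1, ∫₀^∞ i f'(ω)·conj(f(ω)) dω = 0, ∫₀^∞ ln(ω)|f(ω)|² dω = 0, ∫₀^∞ |f'(ω)|² dω ≤ K, and ∫₀^∞ (ln ω)²|f(ω)|² dω ≤ K } is closed in L²((0,∞)). -/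
open MeasureTheory Set Filter Topology
open scoped ENNReal Topology

noncomputable section

/-- The set `K_S ⊂ L²((0,∞)) ⊂ L²(ℝ)`: elements having a representative `f`,
supported in `(0,∞)`, absolutely continuous on every compact interval with
derivative `g` (encoded by `f x = ∫₀ˣ g`), with `f' ∈ L²((0,∞))`,
`ln(ω)f(ω) ∈ L²((0,∞))`, `‖f‖ = 1`, zero expected time and scale, and
`‖T_x f‖² ≤ K`, `‖T_σ f‖² ≤ K`. -/
def KS (K : ℝ) : Set (Lp ℂ 2 (volume : Measure ℝ)) :=
  {F | ∃ f g : ℝ → ℂ, (⇑F =ᵐ[volume] f) ∧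
    (∀ x : ℝ, x ≤ 0 → f x = 0) ∧
    (∀ x : ℝ, IntervalIntegrable g volume 0 x) ∧
    (∀ x : ℝ, f x = ∫ t in (0:ℝ)..x, g t) ∧
    MemLp g 2 (volume.restrict (Set.Ioi (0:ℝ))) ∧
    MemLp (fun ω : ℝ => (Real.log ω : ℂ) * f ω) 2 (volume.restrict (Set.Ioi (0:ℝ))) ∧
    (∫ ω in Set.Ioi (0:ℝ), ‖f ω‖ ^ 2 = 1) ∧
    (∫ ω in Set.Ioi (0:ℝ), Complex.I * g ω * (starRingEnd ℂ) (f ω) = 0) ∧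
    (∫ ω in Set.Ioi (0:ℝ), Real.log ω * ‖f ω‖ ^ 2 = 0) ∧
    (∫ ω in Set.Ioi (0:ℝ), ‖g ω‖ ^ 2 ≤ K) ∧
    (∫ ω in Set.Ioi (0:ℝ), (Real.log ω) ^ 2 * ‖f ω‖ ^ 2 ≤ K)}

/-- The squared norm of an `L²` class as an integral. -/
lemma KS_norm_sq (F : Lp ℂ 2 (volume : Measure ℝ)) : ‖F‖ ^ 2 = ∫ x, ‖F x‖ ^ 2 := by
  have h := @inner_self_eq_norm_sq_to_K ℂ _ _ _ _ F
  rw [L2.inner_def] at h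
  have h2 : ∀ x, inner ℂ (F x) (F x) = ((‖F x‖ ^ 2 : ℝ) : ℂ) := by
    intro x
    rw [inner_self_eq_norm_sq_to_K]; push_cast; rfl
  simp_rw [h2] at h
  rw [integral_complex_ofReal] at h
  have h3 : ((∫ x, ‖F x‖ ^ 2 : ℝ) : ℂ) = ((‖F‖ ^ 2 : ℝ) : ℂ) := by
    rw [h]; push_cast; rfl
  exact (Complex.ofReal_injective h3).symm

/-- Hilbert space reformulation of the conditions defining `KS`. -/
def KSData (K : ℝ) (F G L : Lp ℂ 2 (volume : Measure ℝ)) : Prop :=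
  (F =ᵐ[volume] fun x => ∫ t in Set.Ioc 0 x, G t) ∧
  (L =ᵐ[volume] fun x => (Real.log x : ℂ) * F x) ∧
  ‖F‖ = 1 ∧ inner ℂ F G = 0 ∧ inner ℂ L F = 0 ∧ ‖G‖ ^ 2 ≤ K ∧ ‖L‖ ^ 2 ≤ K

lemma KS_exists_data {K : ℝ} {F : Lp ℂ 2 (volume : Measure ℝ)} (hF : F ∈ KS K) :
    ∃ G L, KSData K F G L := by
  obtain ⟨f, g, hFf, hf0, hgi, hfg, hg, hl, h1, h2, h3, h4, h5⟩ := hF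
  have hg' : MemLp ((Set.Ioi (0:ℝ)).indicator g) 2 volume :=
    (memLp_indicator_iff_restrict measurableSet_Ioi).2 hg
  have hl0 : (Set.Ioi (0:ℝ)).indicator (fun ω : ℝ => (Real.log ω : ℂ) * f ω)
      = fun ω : ℝ => (Real.log ω : ℂ) * f ω := by
    rw [Set.indicator_eq_self]
    intro x hx
    by_contra hx'
    exact hx (by simp [hf0 x (not_lt.1 hx')])
  have hl' : MemLp (fun ω : ℝ => (Real.log ω : ℂ) * f ω) 2 volume := by
    rw [← hl0]; exact (memLp_indicator_iff_restrict measurableSet_Ioi).2 hl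
  have hG := hg'.coeFn_toLp
  have hL := hl'.coeFn_toLp
  refine ⟨hg'.toLp, hl'.toLp, ?_, ?_, ?_, ?_, ?_, ?_, ?_⟩
  · filter_upwards [hFf] with x hx
    rw [hx, integral_congr_ae (ae_restrict_of_ae hG)]
    rcases le_total 0 x with h | h
    · rw [hfg, intervalIntegral.integral_of_le h]
      refine setIntegral_congr_fun measurableSet_Ioc fun t ht => ?_
      simp [ht.1]
    · rw [hf0 x h, Set.Ioc_eq_empty (not_lt.2 h)]; simp
  · filter_upwards [hFf, hL] with x hx hx2
    rw [hx2, hx]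
  · have : ‖F‖ ^ 2 = 1 := by
      rw [KS_norm_sq, ← h1, setIntegral_eq_integral_of_forall_compl_eq_zero]
      · refine integral_congr_ae ?_
        filter_upwards [hFf] with x hx
        rw [hx]
      · intro x hx
        simp [hf0 x (not_lt.1 hx)]
    exact (pow_eq_one_iff_of_nonneg (norm_nonneg _) two_ne_zero).1 this
  · have : Complex.I * inner ℂ F (hg'.toLp) = 0 := by
      rw [← h2, L2.inner_def, setIntegral_eq_integral_of_forall_compl_eq_zero,
        ← integral_const_mul]
      · refine integral_congr_ae ?_
        filter_upwards [hFf, hG] with x hx hx2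
        rw [hx, hx2, RCLike.inner_apply]
        by_cases h : 0 < x
        · simp [h, mul_assoc]
        · simp [hf0 x (not_lt.1 h)]
      · intro x hx
        simp [hf0 x (not_lt.1 hx)]
    simpa using this
  · rw [L2.inner_def, ← Complex.ofReal_zero, ← h3,
      setIntegral_eq_integral_of_forall_compl_eq_zero, ← integral_complex_ofReal]
    · refine integral_congr_ae ?_
      filter_upwards [hFf, hL] with x hx hx2
      rw [hx, hx2, RCLike.inner_apply, map_mul, Complex.conj_ofReal, mul_left_comm,
        Complex.mul_conj']
      push_cast; rfl
    · intro x hx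
      simp [hf0 x (not_lt.1 hx)]
  · rw [KS_norm_sq]
    refine le_of_eq_of_le ?_ h4
    rw [← integral_indicator measurableSet_Ioi]
    refine integral_congr_ae ?_
    filter_upwards [hG] with x hx
    rw [hx]
    by_cases h : 0 < x <;> simp [h]
  · rw [KS_norm_sq]
    refine le_of_eq_of_le ?_ h5
    rw [setIntegral_eq_integral_of_forall_compl_eq_zero]
    · refine integral_congr_ae ?_
      filter_upwards [hL] with x hx
      rw [hx, norm_mul, mul_pow, Complex.norm_real, Real.norm_eq_abs, sq_abs]
    · intro x hx
      simp [hf0 x (not_lt.1 hx)]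

lemma KS_of_data {K : ℝ} {F G L : Lp ℂ 2 (volume : Measure ℝ)} (h : KSData K F G L) :
    F ∈ KS K := by
  obtain ⟨hF, hL, h1, h2, h3, h4, h5⟩ := h
  set g : ℝ → ℂ := (Set.Ioi (0:ℝ)).indicator G with hg
  set f : ℝ → ℂ := fun x => ∫ t in Set.Ioc 0 x, G t with hf
  have hf0 : ∀ x : ℝ, x ≤ 0 → f x = 0 := by
    intro x hx
    simp only [hf]
    rw [Set.Ioc_eq_empty (not_lt.2 hx)]; simp
  have hgm : MemLp g 2 volume := (Lp.memLp G).indicator measurableSet_Ioi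
  have hLf : L =ᵐ[volume] fun x => (Real.log x : ℂ) * f x := by
    filter_upwards [hL, hF] with x hx hx2
    rw [hx, hx2]
  have hLm : MemLp (fun x : ℝ => (Real.log x : ℂ) * f x) 2 volume :=
    (memLp_congr_ae hLf).1 (Lp.memLp L)
  refine ⟨f, g, hF, hf0, ?_, ?_, hgm.restrict _, hLm.restrict _, ?_, ?_, ?_, ?_, ?_⟩
  · intro x
    exact ((hgm.locallyIntegrable (by norm_num)).integrableOn_isCompact
      isCompact_uIcc).intervalIntegrable
  · intro x
    rcases le_total 0 x with h | h
    · rw [intervalIntegral.integral_of_le h]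
      refine setIntegral_congr_fun measurableSet_Ioc fun t ht => ?_
      simp [hg, ht.1]
    · rw [hf0 x h, intervalIntegral.integral_of_ge h, setIntegral_eq_zero_of_forall_eq_zero,
        neg_zero]
      intro t ht
      simp [hg, ht.2]
  · have : ‖F‖ ^ 2 = 1 := by rw [h1]; norm_num
    rw [← this, KS_norm_sq, setIntegral_eq_integral_of_forall_compl_eq_zero]
    · refine integral_congr_ae ?_
      filter_upwards [hF] with x hx
      rw [hx]
    · intro x hx
      simp [hf0 x (not_lt.1 hx)]
  · have : Complex.I * inner ℂ F G = 0 := by rw [h2, mul_zero]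
    rw [← this, L2.inner_def, setIntegral_eq_integral_of_forall_compl_eq_zero,
        ← integral_const_mul]
    · refine integral_congr_ae ?_
      filter_upwards [hF] with x hx
      rw [hx, RCLike.inner_apply]
      by_cases h : 0 < x
      · simp [hg, h, mul_assoc]
      · simp [hf0 x (not_lt.1 h)]
    · intro x hx
      simp [hf0 x (not_lt.1 hx)]
  · apply Complex.ofReal_injective
    rw [Complex.ofReal_zero, ← h3, L2.inner_def,
      setIntegral_eq_integral_of_forall_compl_eq_zero, ← integral_complex_ofReal]
    · refine integral_congr_ae ?_
      filter_upwards [hF, hLf] with x hx hx2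
      rw [hx, hx2, RCLike.inner_apply, map_mul, Complex.conj_ofReal, mul_left_comm,
        Complex.mul_conj']
      push_cast; rfl
    · intro x hx
      simp [hf0 x (not_lt.1 hx)]
  · refine le_trans ?_ h4
    rw [KS_norm_sq]
    refine le_trans (le_of_eq ?_) (setIntegral_le_integral (s := Set.Ioi 0)
      ((memLp_two_iff_integrable_sq_norm (Lp.memLp G).1).1 (Lp.memLp G))
      (Eventually.of_forall fun x => by positivity))
    refine setIntegral_congr_fun measurableSet_Ioi fun t ht => ?_
    simp only [hg, Set.indicator_of_mem ht]
  · refine le_of_eq_of_le ?_ h5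
    rw [KS_norm_sq, setIntegral_eq_integral_of_forall_compl_eq_zero]
    · refine integral_congr_ae ?_
      filter_upwards [hLf] with x hx
      rw [hx, norm_mul, mul_pow, Complex.norm_real, Real.norm_eq_abs, sq_abs]
    · intro x hx
      simp [hf0 x (not_lt.1 hx)]

/-- Bounded sequences converge weakly along any ultrafilter. -/
lemma KS_weak_limit {H : Type*} [NormedAddCommGroup H] [InnerProductSpace ℂ H] [CompleteSpace H]
    (U : Ultrafilter ℕ) (G : ℕ → H) (r : ℝ) (hG : ∀ n, ‖G n‖ ≤ r) :
    ∃ G' : H, ‖G'‖ ≤ r ∧ ∀ h : H, Tendsto (fun n => inner ℂ h (G n)) U (𝓝 (inner ℂ h G')) := by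
  let φ : ℕ → WeakDual ℂ H := fun n => StrongDual.toWeakDual (InnerProductSpace.toDual ℂ H (G n))
  obtain ⟨x, hx, hx2⟩ := (WeakDual.isCompact_closedBall (0 : StrongDual ℂ H) r).ultrafilter_le_nhds
    (U.map φ) (by
      rw [le_principal_iff]
      refine Filter.mem_map.2 (Filter.univ_mem' fun n => ?_)
      change InnerProductSpace.toDual ℂ H (G n) ∈ Metric.closedBall (0 : StrongDual ℂ H) r
      rw [mem_closedBall_zero_iff, LinearIsometryEquiv.norm_map]
      exact hG n)
  refine ⟨(InnerProductSpace.toDual ℂ H).symm (WeakDual.toStrongDual x), ?_, fun h => ?_⟩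
  · rw [LinearIsometryEquiv.norm_map]
    exact mem_closedBall_zero_iff.1 hx
  · have h1 : Tendsto (fun n => (φ n) h) U (𝓝 (x h)) :=
      ((WeakDual.eval_continuous h).tendsto x).comp hx2
    have h2 := (Complex.continuous_conj.tendsto _).comp h1
    have h3 : (starRingEnd ℂ) (x h)
        = inner ℂ h ((InnerProductSpace.toDual ℂ H).symm (WeakDual.toStrongDual x)) := by
      rw [← inner_conj_symm, InnerProductSpace.toDual_symm_apply]; rfl
    rw [h3] at h2
    refine h2.congr fun n => ?_
    rw [← inner_conj_symm h]
    rfl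

lemma KS_log_symm {F F' L L' : Lp ℂ 2 (volume : Measure ℝ)}
    (hL : L =ᵐ[volume] fun x => (Real.log x : ℂ) * F x)
    (hL' : L' =ᵐ[volume] fun x => (Real.log x : ℂ) * F' x) :
    inner ℂ L F' = inner ℂ F L' := by
  rw [L2.inner_def, L2.inner_def]
  refine integral_congr_ae ?_
  filter_upwards [hL, hL'] with x hx hx'
  rw [hx, hx', RCLike.inner_apply, RCLike.inner_apply, map_mul, Complex.conj_ofReal]
  ring

lemma KS_data_limit {K : ℝ} {Fn Gn Ln : ℕ → Lp ℂ 2 (volume : Measure ℝ)}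
    {F : Lp ℂ 2 (volume : Measure ℝ)} (h : ∀ n, KSData K (Fn n) (Gn n) (Ln n))
    (hlim : Tendsto Fn atTop (𝓝 F))
    (hae : ∀ᵐ x, Tendsto (fun n => Fn n x) atTop (𝓝 (F x))) :
    ∃ G L, KSData K F G L := by
  have hK : 0 ≤ K := (sq_nonneg _).trans (h 0).2.2.2.2.2.1
  have hGb : ∀ n, ‖Gn n‖ ≤ √K := fun n => Real.le_sqrt_of_sq_le (h n).2.2.2.2.2.1
  have hLb : ∀ n, ‖Ln n‖ ≤ √K := fun n => Real.le_sqrt_of_sq_le (h n).2.2.2.2.2.2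
  let U : Ultrafilter ℕ := Filter.hyperfilter ℕ
  have hU : (U : Filter ℕ) ≤ atTop := Nat.hyperfilter_le_atTop
  obtain ⟨G, hG, hGw⟩ := KS_weak_limit U Gn (√K) hGb
  -- the log part
  have hFat : eLpNorm (fun x => (Real.log x : ℂ) * F x) 2 volume ≤ ENNReal.ofReal (√K) := by
    have h1 := Lp.eLpNorm_lim_le_liminf_eLpNorm (p := 2) (μ := (volume : Measure ℝ))
      (f := fun n => (Ln n : ℝ → ℂ)) (fun n => Lp.aestronglyMeasurable (Ln n))
      (fun x => (Real.log x : ℂ) * F x) (by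
        have h2 : ∀ᵐ x, ∀ n, Ln n x = (Real.log x : ℂ) * Fn n x :=
          ae_all_iff.2 fun n => (h n).2.1
        filter_upwards [hae, h2] with x hx hx2
        simp_rw [hx2]
        exact hx.const_mul _)
    refine h1.trans ?_
    refine (Filter.liminf_le_liminf (v := fun _ => ENNReal.ofReal (√K))
      (Eventually.of_forall fun n => ?_)).trans_eq (by simp)
    rw [← Lp.enorm_def, ← ofReal_norm]
    exact ENNReal.ofReal_le_ofReal (hLb n)
  have hLm : MemLp (fun x => (Real.log x : ℂ) * F x) 2 volume := by
    refine ⟨?_, hFat.trans_lt ENNReal.ofReal_lt_top⟩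
    exact (Complex.measurable_ofReal.comp Real.measurable_log).aestronglyMeasurable.mul
      (Lp.aestronglyMeasurable F)
  have hL := hLm.coeFn_toLp
  have hLn : ‖hLm.toLp‖ ≤ √K := by
    rw [Lp.norm_toLp]
    exact ENNReal.toReal_le_of_le_ofReal (Real.sqrt_nonneg _) hFat
  have hdiff : Tendsto (fun n => ‖F - Fn n‖) atTop (𝓝 0) := by
    have := (tendsto_const_nhds (x := F)).sub hlim
    simpa using this.norm
  refine ⟨G, hLm.toLp, ?_, hL, ?_, ?_, ?_, ?_, ?_⟩
  · have h2 : ∀ᵐ x, ∀ n, Fn n x = ∫ t in Set.Ioc 0 x, Gn n t := ae_all_iff.2 fun n => (h n).1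
    filter_upwards [hae, h2] with x hx hx2
    refine tendsto_nhds_unique (hx.mono_left hU) ?_
    simp_rw [hx2]
    have hfin : volume (Set.Ioc 0 x) ≠ ⊤ := measure_Ioc_lt_top.ne
    have := hGw (indicatorConstLp 2 measurableSet_Ioc hfin 1)
    simpa only [L2.inner_indicatorConstLp_one] using this
  · refine tendsto_nhds_unique hlim.norm ?_
    simp [(h _).2.2.1]
  · have h1 : Tendsto (fun n => inner ℂ (F - Fn n) (Gn n)) U (𝓝 0) := by
      refine squeeze_zero_norm (a := fun n => ‖F - Fn n‖ * √K) (fun n => ?_) ?_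
      · exact (norm_inner_le_norm _ _).trans
          (mul_le_mul_of_nonneg_left (hGb n) (norm_nonneg _))
      · simpa using (hdiff.mono_left hU).mul_const (√K)
    refine tendsto_nhds_unique (hGw F) (h1.congr fun n => ?_)
    rw [inner_sub_left, (h n).2.2.2.1, sub_zero]
  · have h1 : Tendsto (fun n => inner ℂ (hLm.toLp) (F - Fn n) + inner ℂ (F - Fn n) (Ln n))
        atTop (𝓝 0) := by
      refine squeeze_zero_norm (a := fun n => ‖F - Fn n‖ * (2 * √K)) (fun n => ?_) ?_
      · refine (norm_add_le _ _).trans ?_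
        have e1 := norm_inner_le_norm (𝕜 := ℂ) (hLm.toLp) (F - Fn n)
        have e2 := norm_inner_le_norm (𝕜 := ℂ) (F - Fn n) (Ln n)
        have e3 := mul_le_mul_of_nonneg_left (hLb n) (norm_nonneg (F - Fn n))
        have e4 := mul_le_mul_of_nonneg_right hLn (norm_nonneg (F - Fn n))
        linarith
      · simpa using hdiff.mul_const (2 * √K)
    refine tendsto_nhds_unique tendsto_const_nhds (h1.congr fun n => ?_)
    rw [inner_sub_right, inner_sub_left, KS_log_symm hL (h n).2.1,
      ← KS_log_symm (h n).2.1 (h n).2.1, (h n).2.2.2.2.1]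
    ring
  · exact (Real.le_sqrt (norm_nonneg _) hK).1 hG
  · exact (Real.le_sqrt (norm_nonneg _) hK).1 hLn

/-- For any `K > 0`, the set `K_S` is closed in `L²((0,∞))`. -/
theorem isClosed_KS (K : ℝ) (hK : 0 < K) : IsClosed (KS K) := by
  refine IsSeqClosed.isClosed fun Fn F hFn hlim => ?_
  obtain ⟨ns, hns, hae⟩ := (tendstoInMeasure_of_tendsto_Lp hlim).exists_seq_tendsto_ae
  choose Gn Ln h using fun n => KS_exists_data (hFn (ns n))
  obtain ⟨G, L, hGL⟩ := KS_data_limit h (hlim.comp hns.tendsto_atTop) hae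
  exact KS_of_data hGL
end
end

section
/- Fix K > 0 and let K_S be the set of f ∈ L²((0,∞)) such that f is absolutely continuous on every compact interval of ℝ, f' ∈ L²((0,∞)), ω ↦ ln(ω)f(ω) ∈ L²((0,∞)), ‖f‖_{L²}=1, ∫₀^∞ i f'(ω)·conj(f(ω)) dω = 0, ∫₀^∞ ln(ω)|f(ω)|² dω = 0, ∫₀^∞ |f'(ω)|² dω ≤ K, and ∫₀^∞ (ln ω)²|f(ω)|² dω ≤ K. Then for every ε > 0 there exists a compact subset C of L²((0,∞)) such that for every f ∈ K_S there exists y ∈ C with ‖f − y‖_{L²} < ε. -/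
open MeasureTheory Set Filter Topology
open scoped ENNReal Topology

noncomputable section

lemma aux_norm_sq (G : Lp ℂ 2 (volume : Measure ℝ)) : ‖G‖ ^ 2 = ∫ x, ‖G x‖ ^ 2 := by
  have h : (inner ℂ G G : ℂ) = ∫ x, (inner ℂ (G x) (G x) : ℂ) := L2.inner_def G G
  simp only [inner_self_eq_norm_sq_to_K] at h
  have h2 : ((‖G‖ ^ 2 : ℝ) : ℂ) = ((∫ x, ‖G x‖ ^ 2 : ℝ) : ℂ) := by
    rw [← integral_complex_ofReal]
    push_cast
    exact h
  exact_mod_cast h2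

lemma aux_holder (K : ℝ) (g : ℝ → ℂ) (hg : MemLp g 2 (volume.restrict (Set.Ioi (0:ℝ))))
    (hK : ∫ ω in Set.Ioi (0:ℝ), ‖g ω‖ ^ 2 ≤ K) (a b : ℝ) (ha : 0 ≤ a) (hab : a < b)
    (hi : IntervalIntegrable g volume a b) :
    ‖∫ t in a..b, g t‖ ^ 2 ≤ K * (b - a) := by
  have hsub : Ioc a b ⊆ Ioi (0:ℝ) := fun x hx => lt_of_le_of_lt ha hx.1
  have hg2 : IntegrableOn (fun x => ‖g x‖ ^ 2) (Ioi (0:ℝ)) := hg.norm.integrable_sq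
  have hg2' : IntegrableOn (fun x => ‖g x‖ ^ 2) (Ioc a b) := hg2.mono_set hsub
  have hg1 : IntegrableOn (fun x => ‖g x‖) (Ioc a b) := hi.1.norm
  have h1 : ∫ x in Ioc a b, ‖g x‖ ^ 2 ≤ K := by
    refine le_trans (setIntegral_mono_set hg2 ?_ (Eventually.of_forall hsub)) hK
    exact Eventually.of_forall fun x => by positivity
  set I := ∫ x in Ioc a b, ‖g x‖ with hI
  have h2 : ‖∫ t in a..b, g t‖ ≤ I := by
    rw [intervalIntegral.integral_of_le hab.le]
    exact norm_integral_le_integral_norm _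
  have hd : 0 < b - a := sub_pos.2 hab
  have h3 : 0 ≤ ∫ x in Ioc a b, (‖g x‖ - I / (b - a)) ^ 2 :=
    integral_nonneg fun x => by positivity
  have h4 : ∫ x in Ioc a b, (‖g x‖ - I / (b - a)) ^ 2
      = (∫ x in Ioc a b, ‖g x‖ ^ 2) - 2 * (I / (b - a)) * I + (I / (b - a)) ^ 2 * (b - a) := by
    have : ∀ x, (‖g x‖ - I / (b - a)) ^ 2
      = ‖g x‖ ^ 2 - 2 * (I / (b - a)) * ‖g x‖ + (I / (b - a)) ^ 2 := fun x => by ring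
    simp_rw [this]
    rw [integral_add, integral_sub, integral_const_mul]
    · simp [hab.le]; ring
    · exact hg2'
    · exact hg1.const_mul _
    · exact hg2'.sub (hg1.const_mul _)
    · exact integrable_const _
  have h5 : I ^ 2 / (b - a) ≤ K := by
    have : (∫ x in Ioc a b, ‖g x‖ ^ 2) - 2 * (I / (b - a)) * I + (I / (b - a)) ^ 2 * (b - a)
      = (∫ x in Ioc a b, ‖g x‖ ^ 2) - I ^ 2 / (b - a) := by field_simp; ring
    linarith
  rw [div_le_iff₀ hd] at h5
  exact le_trans (pow_le_pow_left₀ (norm_nonneg _) h2 2) h5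

def stepFn (n : ℕ) (d : ℝ) (c : Fin n → ℂ) : Lp ℂ 2 (volume : Measure ℝ) :=
  ∑ i : Fin n, c i • indicatorConstLp 2 (μ := volume)
    (measurableSet_Ioc (a := (i : ℝ) * d) (b := ((i : ℝ) + 1) * d)) (by simp) (1 : ℂ)

lemma stepFn_coe (n : ℕ) (d : ℝ) (c : Fin n → ℂ) :
    ∀ᵐ x : ℝ, stepFn n d c x =
      ∑ i : Fin n, (Ioc ((i : ℝ) * d) (((i : ℝ) + 1) * d)).indicator (fun _ => c i) x := by
  have h1 : ∀ i : Fin n, ∀ᵐ x : ℝ, (c i • indicatorConstLp 2 (μ := volume)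
    (measurableSet_Ioc (a := (i : ℝ) * d) (b := ((i : ℝ) + 1) * d)) (by simp) (1 : ℂ) :
      Lp ℂ 2 (volume : Measure ℝ)) x =
      (Ioc ((i : ℝ) * d) (((i : ℝ) + 1) * d)).indicator (fun _ => c i) x := by
    intro i
    filter_upwards [Lp.coeFn_smul (c i) (indicatorConstLp 2 (μ := volume)
      (measurableSet_Ioc (a := (i : ℝ) * d) (b := ((i : ℝ) + 1) * d)) (by simp) (1 : ℂ)),
      indicatorConstLp_coeFn (p := 2) (μ := volume)
      (hs := measurableSet_Ioc (a := (i : ℝ) * d) (b := ((i : ℝ) + 1) * d))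
      (hμs := by simp) (c := (1 : ℂ))] with x h1 h2
    rw [h1, Pi.smul_apply, h2]
    simp [indicator_apply]
  have h3 : ∀ᵐ x : ℝ, stepFn n d c x = ∑ i : Fin n, (c i • indicatorConstLp 2 (μ := volume)
    (measurableSet_Ioc (a := (i : ℝ) * d) (b := ((i : ℝ) + 1) * d)) (by simp) (1 : ℂ) :
      Lp ℂ 2 (volume : Measure ℝ)) x := by
    exact Lp.coeFn_fun_finsetSum _ _
  filter_upwards [h3, ae_all_iff.2 h1] with x hx hx1
  rw [hx]
  exact Finset.sum_congr rfl fun i _ => hx1 i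

lemma step_val (n : ℕ) (d : ℝ) (hd : 0 < d) (c : Fin n → ℂ) (x : ℝ) (j : Fin n)
    (hj : x ∈ Ioc ((j : ℝ) * d) (((j : ℝ) + 1) * d)) :
    ∑ i : Fin n, (Ioc ((i : ℝ) * d) (((i : ℝ) + 1) * d)).indicator (fun _ => c i) x = c j := by
  rw [Finset.sum_eq_single j]
  · simp only [indicator_of_mem hj]
  · intro i _ hij
    refine indicator_of_notMem (fun hi => hij ?_) _
    have h1 : (i : ℝ) < j + 1 := lt_of_mul_lt_mul_right (lt_of_lt_of_le hi.1 hj.2) hd.le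
    have h2 : (j : ℝ) < i + 1 := lt_of_mul_lt_mul_right (lt_of_lt_of_le hj.1 hi.2) hd.le
    have h1' : (i : ℕ) < j + 1 := by exact_mod_cast h1
    have h2' : (j : ℕ) < i + 1 := by exact_mod_cast h2
    exact Fin.ext (by omega)
  · simp

lemma step_zero (n : ℕ) (d : ℝ) (c : Fin n → ℂ) (x : ℝ)
    (hj : ∀ i : Fin n, x ∉ Ioc ((i : ℝ) * d) (((i : ℝ) + 1) * d)) :
    ∑ i : Fin n, (Ioc ((i : ℝ) * d) (((i : ℝ) + 1) * d)).indicator (fun _ => c i) x = 0 :=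
  Finset.sum_eq_zero fun i _ => indicator_of_notMem (hj i) _

lemma exists_idx (n : ℕ) (d : ℝ) (hd : 0 < d) (x : ℝ) (hx : 0 < x) (hxn : x ≤ n * d) :
    ∃ j : Fin n, x ∈ Ioc ((j : ℝ) * d) (((j : ℝ) + 1) * d) := by
  have hq : 0 < x / d := by positivity
  have hc : 0 < ⌈x / d⌉₊ := Nat.ceil_pos.2 hq
  have hle : ⌈x / d⌉₊ ≤ n := Nat.ceil_le.2 ((div_le_iff₀ hd).2 hxn)
  obtain ⟨m, hm⟩ : ∃ m, ⌈x / d⌉₊ = m + 1 := ⟨⌈x / d⌉₊ - 1, by omega⟩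
  refine ⟨⟨m, by omega⟩, ?_, ?_⟩
  · have : m < ⌈x / d⌉₊ := by omega
    exact (lt_div_iff₀ hd).1 (Nat.lt_ceil.1 this)
  · have := Nat.le_ceil (x / d)
    rw [hm] at this
    push_cast at this
    exact (div_le_iff₀ hd).1 this

/-- For every `ε > 0` there is a compact subset `C` of `L²((0,∞))` such that
every `f ∈ K_S` is within distance `ε` of some `y ∈ C`. -/
theorem KS_approx_by_compact (K : ℝ) (hK : 0 < K) (ε : ℝ) (hε : 0 < ε) :
    ∃ C : Set (Lp ℂ 2 (volume : Measure ℝ)), IsCompact C ∧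
      (∀ y ∈ C, ∀ᵐ x : ℝ ∂volume, x ≤ 0 → y x = 0) ∧
      ∀ F ∈ KS K, ∃ y ∈ C, ‖F - y‖ < ε := by
  obtain ⟨R, hR1, hRK⟩ : ∃ R : ℝ, 1 < R ∧ K / (Real.log R) ^ 2 < ε ^ 2 / 2 := by
    have ht : Tendsto (fun R : ℝ => K / (Real.log R) ^ 2) atTop (𝓝 0) :=
      tendsto_const_nhds.div_atTop
        ((tendsto_pow_atTop (two_ne_zero)).comp Real.tendsto_log_atTop)
    obtain ⟨R, h1, h2⟩ := ((eventually_gt_atTop (1:ℝ)).and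
      (ht.eventually (gt_mem_nhds (show (0:ℝ) < ε ^ 2 / 2 by positivity)))).exists
    exact ⟨R, h1, h2⟩
  have hR0 : 0 < R := by linarith
  have hlog : 0 < Real.log R := Real.log_pos hR1
  obtain ⟨n, hn⟩ := exists_nat_gt (K * R * R / (ε ^ 2 / 2))
  have hn0 : (0:ℝ) < n := lt_of_le_of_lt (by positivity) hn
  set d := R / n with hd_def
  have hd : 0 < d := by positivity
  have hnd : n * d = R := by rw [hd_def]; field_simp
  have hKd : K * d * R < ε ^ 2 / 2 := by
    rw [div_lt_iff₀ (by positivity)] at hn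
    rw [hd_def, show K * (R / n) * R = K * R * R / n by ring, div_lt_iff₀ hn0]
    linarith
  refine ⟨Set.image (stepFn n d) (Set.univ.pi fun _ => Metric.closedBall (0:ℂ) (Real.sqrt (K * R))),
    ?_, ?_, ?_⟩
  · refine (isCompact_univ_pi fun _ => isCompact_closedBall _ _).image ?_
    unfold stepFn
    fun_prop
  · rintro y ⟨c, -, rfl⟩
    filter_upwards [stepFn_coe n d c] with x hx hx0
    rw [hx]
    refine step_zero _ _ _ _ fun i hi => ?_
    have : 0 ≤ (i : ℝ) * d := by positivity
    linarith [hi.1]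
  · rintro F ⟨f, g, hFf, hf0, hgi, hfg, hg2, hlf, -, -, -, hgK, hlK⟩
    have hold : ∀ a b : ℝ, 0 ≤ a → a < b → ‖f b - f a‖ ^ 2 ≤ K * (b - a) := by
      intro a b ha hab
      have hi : IntervalIntegrable g volume a b := (hgi a).symm.trans (hgi b)
      have : f b - f a = ∫ t in a..b, g t := by
        rw [hfg, hfg, intervalIntegral.integral_interval_sub_left (hgi b) (hgi a)]
      rw [this]
      exact aux_holder K g hg2 hgK a b ha hab hi
    set c : Fin n → ℂ := fun i => f ((i : ℝ) * d) with hc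
    refine ⟨stepFn n d c, ⟨c, ?_, rfl⟩, ?_⟩
    · intro i _
      rw [mem_closedBall_zero_iff]
      apply Real.le_sqrt_of_sq_le
      have hiR : (i : ℝ) * d ≤ R := by
        rw [← hnd]
        have : (i : ℝ) ≤ n := by exact_mod_cast i.2.le
        gcongr
      have hi0 : 0 ≤ (i : ℝ) * d := by positivity
      rcases hi0.eq_or_lt with h | h
      · simp only [hc, ← h, hf0 0 le_rfl]
        simp; positivity
      · have := hold 0 _ le_rfl h
        rw [hf0 0 le_rfl, sub_zero, sub_zero] at this
        exact this.trans (by gcongr)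
    · have hlint : IntegrableOn (fun ω => (Real.log ω) ^ 2 * ‖f ω‖ ^ 2) (Ioi (0:ℝ)) := by
        have := hlf.norm.integrable_sq
        refine this.congr (Eventually.of_forall fun x => ?_)
        simp [mul_pow]
      have hsub : Ioi R ⊆ Ioi (0:ℝ) := Ioi_subset_Ioi hR0.le
      set h : ℝ → ℝ := fun x => (Ioc 0 R).indicator (fun _ => K * d) x +
        (Ioi R).indicator (fun ω => (Real.log ω) ^ 2 * ‖f ω‖ ^ 2 / (Real.log R) ^ 2) x with hh
      have hi1 : Integrable ((Ioc 0 R).indicator (fun _ => K * d)) (volume : Measure ℝ) :=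
        (integrable_indicator_iff measurableSet_Ioc).2 (integrable_const _)
      have hi2 : Integrable ((Ioi R).indicator
          (fun ω => (Real.log ω) ^ 2 * ‖f ω‖ ^ 2 / (Real.log R) ^ 2)) (volume : Measure ℝ) :=
        (integrable_indicator_iff measurableSet_Ioi).2 ((hlint.mono_set hsub).div_const _)
      have hint : ∫ x, h x ≤ K * d * R + K / (Real.log R) ^ 2 := by
        rw [hh, integral_add hi1 hi2, integral_indicator measurableSet_Ioc,
          integral_indicator measurableSet_Ioi, integral_div]
        have : ∫ ω in Ioi R, (Real.log ω) ^ 2 * ‖f ω‖ ^ 2 ≤ K := by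
          refine le_trans (setIntegral_mono_set hlint ?_ (Eventually.of_forall hsub)) hlK
          exact Eventually.of_forall fun x => by positivity
        refine add_le_add ?_ (by gcongr)
        simp [hR0.le]
        linarith
      have hb : ∫ x, ‖(F - stepFn n d c : Lp ℂ 2 (volume : Measure ℝ)) x‖ ^ 2 ≤ ∫ x, h x := by
        refine integral_mono_of_nonneg (Eventually.of_forall fun x => by positivity)
          (hi1.add hi2) ?_
        filter_upwards [Lp.coeFn_sub F (stepFn n d c), hFf, stepFn_coe n d c] with x h1 h2 h3
        rw [h1, Pi.sub_apply, h2, h3]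
        rcases le_or_gt x 0 with hx | hx
        · rw [step_zero, hf0 x hx]
          · simp [hh, indicator_apply, not_lt.2 hx, not_lt.2 (hx.trans hR0.le)]
          · intro i hi
            have : 0 ≤ (i : ℝ) * d := by positivity
            linarith [hi.1]
        rcases le_or_gt x R with hxR | hxR
        · obtain ⟨j, hj⟩ := exists_idx n d hd x hx (hnd ▸ hxR)
          rw [step_val n d hd c x j hj]
          have h5 := hold ((j : ℝ) * d) x (by positivity) hj.1
          have h6 : h x = K * d := by
            simp [hh, indicator_apply, hx, hxR, not_lt.2 hxR]
          rw [h6]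
          refine h5.trans ?_
          gcongr
          linarith [hj.2]
        · rw [step_zero]
          · have h6 : h x = (Real.log x) ^ 2 * ‖f x‖ ^ 2 / (Real.log R) ^ 2 := by
              simp [hh, indicator_apply, hxR, not_le.2 hxR]
            rw [h6, sub_zero, le_div_iff₀ (by positivity), mul_comm]
            have : Real.log R ≤ Real.log x := Real.log_le_log hR0 hxR.le
            gcongr
          · intro i hi
            have : ((i : ℝ) + 1) ≤ n := by exact_mod_cast i.2
            have : ((i : ℝ) + 1) * d ≤ n * d := by gcongr
            linarith [hi.2]
      rw [← aux_norm_sq] at hb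
      exact lt_of_pow_lt_pow_left₀ 2 hε.le (by linarith)
end
end

section
/- Fix K > 0 and let K_S be the set of f ∈ L²((0,∞)) such that f is absolutely continuous on every compact interval of ℝ, f' ∈ L²((0,∞)), ω ↦ ln(ω)f(ω) ∈ L²((0,∞)), ‖f‖_{L²}=1, ∫₀^∞ i f'(ω)·conj(f(ω)) dω = 0, ∫₀^∞ ln(ω)|f(ω)|² dω = 0, ∫₀^∞ |f'(ω)|² dω ≤ K, and ∫₀^∞ (ln ω)²|f(ω)|² dω ≤ K. Then K_S is pre-compact in L²((0,∞)): every sequence in K_S has a subsequence converging in the L² norm. -/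
open MeasureTheory Set Filter Topology
open scoped ENNReal Topology

noncomputable section

/-- The quantitative Hölder-type estimate coming from the bound on the derivative. -/
theorem KS_holder {K : ℝ} (hK : 0 < K) {f g : ℝ → ℂ}
    (hg : ∀ x : ℝ, IntervalIntegrable g volume 0 x)
    (hf : ∀ x : ℝ, f x = ∫ t in (0:ℝ)..x, g t)
    (hg2 : MemLp g 2 (volume.restrict (Set.Ioi (0:ℝ))))
    (hgK : ∫ ω in Set.Ioi (0:ℝ), ‖g ω‖ ^ 2 ≤ K)
    {x y η : ℝ} (hx : 0 ≤ x) (hxy : x ≤ y) (hη : 0 < η) (hd : (y - x) * K ≤ η ^ 2) :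
    ‖f y - f x‖ ≤ η := by
  have h1 : f y - f x = ∫ t in x..y, g t := by
    rw [hf, hf, intervalIntegral.integral_interval_sub_left (hg y) (hg x)]
  have hint : IntegrableOn (fun t => ‖g t‖ ^ 2) (Set.Ioi (0:ℝ)) := hg2.integrable_norm_pow (by norm_num)
  have hsub : Set.Ioc x y ⊆ Set.Ioi 0 := fun t ht => lt_of_le_of_lt hx ht.1
  have hgi : IntegrableOn g (Set.Ioc x y) := by
    have := (hg x).symm.trans (hg y)
    exact (intervalIntegrable_iff_integrableOn_Ioc_of_le hxy).1 this
  have h2 : ‖∫ t in x..y, g t‖ ≤ ∫ t in Set.Ioc x y, ‖g t‖ := by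
    rw [intervalIntegral.integral_of_le hxy]
    exact norm_integral_le_integral_norm _
  have h3 : ∫ t in Set.Ioc x y, ‖g t‖ ≤
      ∫ t in Set.Ioc x y, (η / (2 * K) * ‖g t‖ ^ 2 + K / (2 * η)) := by
    refine integral_mono hgi.norm (((hint.mono_set hsub).const_mul _).add (integrable_const _)) ?_
    intro t
    have : η / (2 * K) * ‖g t‖ ^ 2 + K / (2 * η) - ‖g t‖ = (η * ‖g t‖ - K) ^ 2 / (2 * K * η) := by
      field_simp
      ring
    have h' : 0 ≤ (η * ‖g t‖ - K) ^ 2 / (2 * K * η) := by positivity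
    simp only
    linarith
  have h4 : ∫ t in Set.Ioc x y, ‖g t‖ ^ 2 ≤ K :=
    (setIntegral_mono_set hint (Eventually.of_forall fun t => by positivity)
      (Eventually.of_forall hsub)).trans hgK
  rw [integral_add ((hint.mono_set hsub).const_mul _) (integrable_const _), integral_const_mul,
    setIntegral_const] at h3
  have h5 : volume.real (Set.Ioc x y) = y - x := by
    simp [Measure.real, Real.volume_Ioc, hxy]
  rw [h5, smul_eq_mul] at h3
  rw [h1]
  have h6 : η / (2 * K) * ∫ t in Set.Ioc x y, ‖g t‖ ^ 2 ≤ η / (2 * K) * K := by gcongr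
  have h7 : η / (2 * K) * K = η / 2 := by field_simp
  have h8 : (y - x) * (K / (2 * η)) ≤ η / 2 := by
    rw [← mul_div_assoc, div_le_div_iff₀ (by positivity) (by positivity)]
    nlinarith
  linarith

/-- Integral bound for the difference of two elements. -/
theorem KS_dist {K : ℝ} (F H : Lp ℂ 2 (volume : Measure ℝ)) {f h : ℝ → ℂ}
    (hF : ⇑F =ᵐ[volume] f) (hH : ⇑H =ᵐ[volume] h)
    (hf0 : ∀ x : ℝ, x ≤ 0 → f x = 0) (hh0 : ∀ x : ℝ, x ≤ 0 → h x = 0)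
    (hf2 : MemLp (fun ω : ℝ => (Real.log ω : ℂ) * f ω) 2 (volume.restrict (Set.Ioi (0:ℝ))))
    (hh2 : MemLp (fun ω : ℝ => (Real.log ω : ℂ) * h ω) 2 (volume.restrict (Set.Ioi (0:ℝ))))
    (hfK : ∫ ω in Set.Ioi (0:ℝ), (Real.log ω) ^ 2 * ‖f ω‖ ^ 2 ≤ K)
    (hhK : ∫ ω in Set.Ioi (0:ℝ), (Real.log ω) ^ 2 * ‖h ω‖ ^ 2 ≤ K)
    {L c : ℝ} (hL : 0 < L) (hc : ∀ x, 0 < x → x ≤ Real.exp L → ‖f x - h x‖ ≤ c) :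
    dist F H ^ 2 ≤ Real.exp L * c ^ 2 + 4 * K / L ^ 2 := by
  have key : ∀ u : ℝ → ℂ,
      MemLp (fun ω : ℝ => (Real.log ω : ℂ) * u ω) 2 (volume.restrict (Set.Ioi (0:ℝ))) →
      IntegrableOn (fun ω => (Real.log ω) ^ 2 * ‖u ω‖ ^ 2) (Set.Ioi 0) := by
    intro u hu
    have := hu.integrable_norm_pow (by norm_num)
    refine this.congr (Eventually.of_forall fun t => ?_)
    simp [mul_pow]
  have hfi := key f hf2
  have hhi := key h hh2
  have hFH : ⇑(F - H) =ᵐ[volume] fun x => f x - h x := by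
    filter_upwards [Lp.coeFn_sub F H, hF, hH] with x h1 h2 h3
    rw [h1, Pi.sub_apply, h2, h3]
  have hm : MemLp (fun x => f x - h x) 2 volume := (Lp.memLp (F - H)).ae_eq hFH
  have hsq : Integrable (fun x => ‖f x - h x‖ ^ 2) := hm.integrable_norm_pow (by norm_num)
  have h1 : dist F H ^ 2 = ∫ x, ‖f x - h x‖ ^ 2 := by
    rw [dist_eq_norm]
    have h3 : (inner ℂ (F - H) (F - H) : ℂ) = ((‖F - H‖ ^ 2 : ℝ) : ℂ) := by
      rw [inner_self_eq_norm_sq_to_K]; simp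
    rw [L2.inner_def] at h3
    have h4 : ∫ a, inner ℂ ((F - H) a) ((F - H) a) = ∫ a, ((‖f a - h a‖ ^ 2 : ℝ) : ℂ) := by
      refine integral_congr_ae ?_
      filter_upwards [hFH] with a ha
      rw [ha, inner_self_eq_norm_sq_to_K]; simp
    rw [h4, integral_complex_ofReal] at h3
    exact_mod_cast h3.symm
  have h2 : ∫ x, ‖f x - h x‖ ^ 2 = ∫ x in Set.Ioi (0:ℝ), ‖f x - h x‖ ^ 2 := by
    symm
    refine setIntegral_eq_integral_of_forall_compl_eq_zero fun x hx => ?_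
    have : x ≤ 0 := by simpa using hx
    simp [hf0 x this, hh0 x this]
  have hind : Integrable ((Set.Ioc 0 (Real.exp L)).indicator fun _ : ℝ => c ^ 2) :=
    (integrable_indicator_iff measurableSet_Ioc).2 (integrableOn_const (by simp))
  have h3 : ∫ x in Set.Ioi (0:ℝ), ‖f x - h x‖ ^ 2 ≤
      ∫ x in Set.Ioi (0:ℝ), ((Set.Ioc 0 (Real.exp L)).indicator (fun _ : ℝ => c ^ 2) x +
        2 / L ^ 2 * ((Real.log x) ^ 2 * ‖f x‖ ^ 2 + (Real.log x) ^ 2 * ‖h x‖ ^ 2)) := by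
    refine setIntegral_mono_on hsq.integrableOn
      (hind.integrableOn.add ((hfi.add hhi).const_mul _)) measurableSet_Ioi fun x hx => ?_
    have hx0 : 0 < x := hx
    by_cases hxR : x ≤ Real.exp L
    · rw [Set.indicator_of_mem (show x ∈ Set.Ioc 0 (Real.exp L) from ⟨hx0, hxR⟩)]
      have := hc x hx0 hxR
      have h' : ‖f x - h x‖ ^ 2 ≤ c ^ 2 := by gcongr
      have h'' : 0 ≤ 2 / L ^ 2 * ((Real.log x) ^ 2 * ‖f x‖ ^ 2 + (Real.log x) ^ 2 * ‖h x‖ ^ 2) := by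
        positivity
      linarith
    · rw [Set.indicator_of_notMem (fun hm => hxR hm.2), zero_add]
      have hl : L ≤ Real.log x := (Real.le_log_iff_exp_le hx0).2 (not_le.1 hxR).le
      have hl2 : 1 ≤ (Real.log x) ^ 2 / L ^ 2 := by
        rw [one_le_div (by positivity)]
        gcongr
      have ht := norm_sub_le (f x) (h x)
      have h' : ‖f x - h x‖ ^ 2 ≤ 2 * (‖f x‖ ^ 2 + ‖h x‖ ^ 2) := by
        have : ‖f x - h x‖ ^ 2 ≤ (‖f x‖ + ‖h x‖) ^ 2 := by gcongr
        nlinarith [sq_nonneg (‖f x‖ - ‖h x‖)]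
      calc ‖f x - h x‖ ^ 2 ≤ 1 * (2 * (‖f x‖ ^ 2 + ‖h x‖ ^ 2)) := by linarith
        _ ≤ (Real.log x) ^ 2 / L ^ 2 * (2 * (‖f x‖ ^ 2 + ‖h x‖ ^ 2)) := by gcongr
        _ = _ := by ring
  have hsum : IntegrableOn (fun x => 2 / L ^ 2 *
      ((Real.log x) ^ 2 * ‖f x‖ ^ 2 + (Real.log x) ^ 2 * ‖h x‖ ^ 2)) (Set.Ioi 0) :=
    (hfi.add hhi).const_mul _
  rw [integral_add hind.integrableOn hsum, integral_const_mul,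
    integral_add hfi hhi] at h3
  have h4 : ∫ x in Set.Ioi (0:ℝ), (Set.Ioc 0 (Real.exp L)).indicator (fun _ : ℝ => c ^ 2) x =
      Real.exp L * c ^ 2 := by
    rw [setIntegral_indicator measurableSet_Ioc,
      Set.inter_eq_right.2 (Set.Ioc_subset_Ioi_self : Set.Ioc 0 (Real.exp L) ⊆ Set.Ioi 0), setIntegral_const]
    simp [Measure.real, Real.volume_Ioc, (Real.exp_pos L).le]
  rw [h4] at h3
  rw [h1, h2]
  have h5 : 2 / L ^ 2 * ((∫ x in Set.Ioi (0:ℝ), (Real.log x) ^ 2 * ‖f x‖ ^ 2) +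
      ∫ x in Set.Ioi (0:ℝ), (Real.log x) ^ 2 * ‖h x‖ ^ 2) ≤ 2 / L ^ 2 * (K + K) := by gcongr
  have h6 : 2 / L ^ 2 * (K + K) = 4 * K / L ^ 2 := by ring
  linarith

/-- The set `K_S` is pre-compact in `L²((0,∞))`: its closure is compact,
equivalently every sequence in `K_S` has a subsequence converging in `L²` norm. -/
theorem KS_precompact (K : ℝ) (hK : 0 < K) :
    IsCompact (closure (KS K)) := by
  refine TotallyBounded.isCompact_of_isClosed (TotallyBounded.closure ?_) isClosed_closure
  refine Metric.totallyBounded_of_finite_discretization fun ε hε => ?_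
  choose! f g hF h0 hgi hfg hg2 hl2 _ _ _ hgK hlK using
    (fun (F : Lp ℂ 2 (volume : Measure ℝ)) (hF : F ∈ KS K) => hF)
  set L : ℝ := 1 + 16 * K / ε ^ 2 with hLdef
  have hLp : 1 ≤ L := by
    have : 0 ≤ 16 * K / ε ^ 2 := by positivity
    linarith
  have hL0 : 0 < L := by linarith
  set R := Real.exp L with hR
  have hRp : 1 ≤ R := Real.one_le_exp hL0.le
  set η := ε / (8 * R) with hηdef
  have hη : 0 < η := by positivity
  set d := η ^ 2 / K with hd
  have hdp : 0 < d := by positivity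
  set N := ⌊R / d⌋₊ + 1 with hN
  let φ : Lp ℂ 2 (volume : Measure ℝ) → (Fin N → ℂ) := fun F i => f F (i * d)
  have hbd : φ '' (KS K) ⊆ Metric.closedBall 0 (1 + R * K) := by
    rintro _ ⟨F, hFm, rfl⟩
    rw [mem_closedBall_zero_iff, pi_norm_le_iff_of_nonneg (by positivity)]
    intro i
    have hi : (i : ℝ) * d ≤ R := by
      have h1 : (i : ℕ) ≤ ⌊R / d⌋₊ := Nat.lt_succ_iff.1 i.2
      have h2 : ((i : ℕ) : ℝ) ≤ R / d := (Nat.le_floor_iff (by positivity)).1 h1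
      exact (le_div_iff₀ hdp).1 h2
    have := KS_holder hK (hgi F hFm) (hfg F hFm) (hg2 F hFm) (hgK F hFm) (x := 0) (y := i * d)
      (η := 1 + R * K) le_rfl (by positivity) (by positivity) (by
        have : ((i : ℝ) * d - 0) * K ≤ R * K := by
          rw [sub_zero]; gcongr
        have : 0 ≤ R * K := by positivity
        nlinarith)
    rwa [h0 F hFm 0 le_rfl, sub_zero] at this
  have htb : TotallyBounded (φ '' (KS K)) :=
    (isCompact_closedBall (0 : Fin N → ℂ) (1 + R * K)).totallyBounded.subset hbd
  obtain ⟨t, htf, ht⟩ := Metric.totallyBounded_iff.1 htb η hη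
  have hex : ∀ F : KS K, ∃ y : t, dist (φ F) y < η := by
    intro F
    have := ht (mem_image_of_mem φ F.2)
    simp only [mem_iUnion, Metric.mem_ball] at this
    obtain ⟨y, hy, h⟩ := this
    exact ⟨⟨y, hy⟩, h⟩
  choose ψ hψ using hex
  refine ⟨t, htf.fintype, ψ, fun F H hFH => ?_⟩
  have hφ : dist (φ F) (φ H) ≤ 2 * η := by
    have h1 := hψ F
    have h2 := hψ H
    rw [hFH] at h1
    have := dist_triangle_right (φ F) (φ H) (ψ H : Fin N → ℂ)
    linarith
  have hc : ∀ x, 0 < x → x ≤ Real.exp L → ‖f F x - f H x‖ ≤ 4 * η := by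
    intro x hx hxR
    have hiN : ⌊x / d⌋₊ < N := Nat.lt_succ_iff.2 (Nat.floor_le_floor (by gcongr))
    have hx1 : (⌊x / d⌋₊ : ℝ) * d ≤ x := (le_div_iff₀ hdp).1 (Nat.floor_le (by positivity))
    have hx2 : x < ((⌊x / d⌋₊ : ℝ) + 1) * d := (div_lt_iff₀ hdp).1 (Nat.lt_floor_add_one _)
    have hstep : (x - (⌊x / d⌋₊ : ℝ) * d) * K ≤ η ^ 2 := by
      have : d * K = η ^ 2 := by rw [hd]; field_simp
      rw [← this]
      gcongr
      linarith
    have e1 := KS_holder hK (hgi F F.2) (hfg F F.2) (hg2 F F.2) (hgK F F.2)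
      (x := (⌊x / d⌋₊ : ℝ) * d) (y := x) (by positivity) hx1 hη hstep
    have e2 := KS_holder hK (hgi H H.2) (hfg H H.2) (hg2 H H.2) (hgK H H.2)
      (x := (⌊x / d⌋₊ : ℝ) * d) (y := x) (by positivity) hx1 hη hstep
    have e3 : ‖f F ((⌊x / d⌋₊ : ℝ) * d) - f H ((⌊x / d⌋₊ : ℝ) * d)‖ ≤ 2 * η := by
      have := (dist_le_pi_dist (φ F) (φ H) ⟨_, hiN⟩).trans hφ
      rwa [dist_eq_norm] at this
    have e4 : f F x - f H x = (f F x - f F ((⌊x / d⌋₊ : ℝ) * d)) +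
        (f F ((⌊x / d⌋₊ : ℝ) * d) - f H ((⌊x / d⌋₊ : ℝ) * d)) -
        (f H x - f H ((⌊x / d⌋₊ : ℝ) * d)) := by ring
    rw [e4]
    refine (norm_sub_le _ _).trans ?_
    have := norm_add_le (f F x - f F ((⌊x / d⌋₊ : ℝ) * d))
        (f F ((⌊x / d⌋₊ : ℝ) * d) - f H ((⌊x / d⌋₊ : ℝ) * d))
    linarith
  have hfin := KS_dist (F : Lp ℂ 2 (volume : Measure ℝ)) H (hF F F.2) (hF H H.2) (h0 F F.2)
    (h0 H H.2) (hl2 F F.2) (hl2 H H.2) (hlK F F.2) (hlK H H.2) hL0 hc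
  have b1 : Real.exp L * (4 * η) ^ 2 ≤ ε ^ 2 / 4 := by
    have : R * (4 * η) ^ 2 = ε ^ 2 / 4 / R := by
      rw [hηdef]; field_simp; norm_num
    rw [← hR, this]
    exact div_le_self (by positivity) hRp
  have b2 : 4 * K / L ^ 2 ≤ ε ^ 2 / 4 := by
    have h1 : L ≤ L ^ 2 := by nlinarith
    have h2 : 16 * K / ε ^ 2 ≤ L ^ 2 := by linarith
    rw [div_le_iff₀ (by positivity)] at h2
    rw [div_le_iff₀ (by positivity)]
    linarith
  have hε2 : 0 < ε ^ 2 := by positivity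
  exact lt_of_pow_lt_pow_left₀ 2 hε.le (by linarith)
end
end

section
/- Let M > 0 and let f ∈ L²((0,∞)) be absolutely continuous on every compact interval with f(0) = 0, ‖f‖_{L²} = 1, f' ∈ L²((0,∞)) and ∫₀^∞ |f'(ω)|² dω ≤ M. Then ∫₀^∞ |f(ω)|²/ω dω ≤ M + 1. -/
open MeasureTheory Set Filter Topology
open scoped ENNReal Topology

noncomputable section

theorem pointwise_bound (M : ℝ) (f g : ℝ → ℂ)
    (hgint : ∀ x : ℝ, IntervalIntegrable g volume 0 x)
    (hfg : ∀ x : ℝ, f x = ∫ t in (0:ℝ)..x, g t)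
    (hg : MemLp g 2 (volume.restrict (Set.Ioi (0:ℝ))))
    (hgM : ∫ ω in Set.Ioi (0:ℝ), ‖g ω‖ ^ 2 ≤ M) (w : ℝ) (hw : 0 < w) :
    ‖f w‖ ^ 2 / w ≤ M := by
  have hg2 : IntegrableOn (fun t => ‖g t‖ ^ 2) (Ioi 0) := hg.integrable_norm_pow (by norm_num)
  have hg2w : IntervalIntegrable (fun t => ‖g t‖ ^ 2) volume 0 w :=
    (intervalIntegrable_iff_integrableOn_Ioc_of_le hw.le).2 (hg2.mono_set Ioc_subset_Ioi_self)
  have h1 : ∫ t in (0:ℝ)..w, ‖g t‖ ^ 2 ≤ M := by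
    rw [intervalIntegral.integral_of_le hw.le]
    refine le_trans (setIntegral_mono_set hg2 ?_ ?_) hgM
    · exact Eventually.of_forall fun t => by positivity
    · exact (Ioc_subset_Ioi_self).eventuallyLE
  have hA : ‖f w‖ ≤ ∫ t in (0:ℝ)..w, ‖g t‖ := by
    rw [hfg]; exact intervalIntegral.norm_integral_le_integral_norm hw.le
  set A := ∫ t in (0:ℝ)..w, ‖g t‖ with hAdef
  have h2 : 0 ≤ ∫ t in (0:ℝ)..w, (‖g t‖ - A / w) ^ 2 :=
    intervalIntegral.integral_nonneg hw.le fun t _ => sq_nonneg _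
  have h3 : ∫ t in (0:ℝ)..w, (‖g t‖ - A / w) ^ 2
      = (∫ t in (0:ℝ)..w, ‖g t‖ ^ 2) - 2 * (A / w) * A + w * (A / w) ^ 2 := by
    have : ∀ t, (‖g t‖ - A / w) ^ 2 = ‖g t‖ ^ 2 - 2 * (A / w) * ‖g t‖ + (A / w) ^ 2 :=
      fun t => by ring
    simp_rw [this]
    have hn := ((hgint w).norm.const_mul (2 * (A / w)))
    rw [intervalIntegral.integral_add (hg2w.sub hn) (by simp),
      intervalIntegral.integral_sub hg2w hn, intervalIntegral.integral_const_mul]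
    simp [hAdef]
  have h4 : w * (A / w) ^ 2 = A ^ 2 / w := by field_simp
  have h5 : 2 * (A / w) * A = 2 * (A ^ 2 / w) := by ring
  have h6 : ‖f w‖ ^ 2 / w ≤ A ^ 2 / w := by gcongr
  linarith

/-- If `f ∈ L²((0,∞))` is absolutely continuous on every compact interval with
`f 0 = 0` (encoded by `f x = ∫₀ˣ g` and `f = 0` on `(-∞,0]`), `‖f‖_{L²} = 1`,
`g = f' ∈ L²((0,∞))` and `∫₀^∞ |f'(ω)|² dω ≤ M`, then the squared window-space
norm satisfies `∫₀^∞ |f(ω)|²/ω dω ≤ M + 1`. -/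
theorem window_norm_bound (M : ℝ) (hM : 0 < M) (f g : ℝ → ℂ)
    (hf : MemLp f 2 (volume : Measure ℝ))
    (hsupp : ∀ x : ℝ, x ≤ 0 → f x = 0)
    (hnorm : ∫ ω in Set.Ioi (0:ℝ), ‖f ω‖ ^ 2 = 1)
    (hgint : ∀ x : ℝ, IntervalIntegrable g volume 0 x)
    (hfg : ∀ x : ℝ, f x = ∫ t in (0:ℝ)..x, g t)
    (hg : MemLp g 2 (volume.restrict (Set.Ioi (0:ℝ))))
    (hgM : ∫ ω in Set.Ioi (0:ℝ), ‖g ω‖ ^ 2 ≤ M) :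
    ∫⁻ ω in Set.Ioi (0:ℝ), ENNReal.ofReal (‖f ω‖ ^ 2 / ω) ≤ ENNReal.ofReal (M + 1) := by
  have hb := pointwise_bound M f g hgint hfg hg hgM
  have hf2 : Integrable (fun t => ‖f t‖ ^ 2) volume := hf.integrable_norm_pow (by norm_num)
  rw [← Ioc_union_Ioi_eq_Ioi (zero_le_one (α := ℝ)),
    lintegral_union measurableSet_Ioi (Ioc_disjoint_Ioi le_rfl),
    ENNReal.ofReal_add hM.le zero_le_one]
  refine add_le_add ?_ ?_
  · calc _ ≤ ∫⁻ ω in Ioc (0:ℝ) 1, ENNReal.ofReal M :=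
          setLIntegral_mono measurable_const fun w hw => ENNReal.ofReal_le_ofReal (hb w hw.1)
      _ = ENNReal.ofReal M := by simp
  · calc _ ≤ ∫⁻ ω in Ioi (1:ℝ), ENNReal.ofReal (‖f ω‖ ^ 2) := by
          refine setLIntegral_mono' measurableSet_Ioi fun w hw => ENNReal.ofReal_le_ofReal ?_
          exact div_le_self (by positivity) (le_of_lt hw)
      _ ≤ ∫⁻ ω in Ioi (0:ℝ), ENNReal.ofReal (‖f ω‖ ^ 2) :=
          lintegral_mono_set (Ioi_subset_Ioi zero_le_one)
      _ = ENNReal.ofReal 1 := by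
          rw [← hnorm, ofReal_integral_eq_lintegral_ofReal hf2.integrableOn]
          exact Eventually.of_forall fun t => by positivity
end
end

section
/- Let f ∈ L²((0,∞)) satisfy ‖f‖_{L²} = 1, ∫₀^∞ |ln(ω)||f(ω)|² dω < ∞ and ∫₀^∞ ln(ω)|f(ω)|² dω = 0. Then ∫₀^∞ |f(ω)|²/ω² dω ≥ 1/(2e²). -/
open MeasureTheory Set Filter Topology
open scoped ENNReal Topology

noncomputable section

/-- If `f ∈ L²((0,∞))` satisfies `‖f‖_{L²} = 1`, `∫₀^∞ |ln ω||f(ω)|² dω < ∞` and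
`∫₀^∞ ln(ω)|f(ω)|² dω = 0`, then `∫₀^∞ |f(ω)|²/ω² dω ≥ 1/(2e²)` (the left-hand
side being allowed to equal `+∞`). -/
theorem window_frac_lower_bound (f : ℝ → ℂ)
    (hf : MemLp f 2 (volume : Measure ℝ))
    (hsupp : ∀ᵐ x : ℝ ∂volume, x ≤ 0 → f x = 0)
    (hnorm : ∫ ω in Set.Ioi (0:ℝ), ‖f ω‖ ^ 2 = 1)
    (habs : ∫⁻ ω in Set.Ioi (0:ℝ), ENNReal.ofReal (|Real.log ω| * ‖f ω‖ ^ 2) < ⊤)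
    (hmean : ∫ ω in Set.Ioi (0:ℝ), Real.log ω * ‖f ω‖ ^ 2 = 0) :
    ENNReal.ofReal (1 / (2 * Real.exp 1 ^ 2))
      ≤ ∫⁻ ω in Set.Ioi (0:ℝ), ENNReal.ofReal (‖f ω‖ ^ 2 / ω ^ 2) := by
  have hm2 : AEStronglyMeasurable (fun ω => ‖f ω‖ ^ 2) (volume.restrict (Set.Ioi (0:ℝ))) :=
    (hf.1.norm.pow 2).restrict
  have hi1 : Integrable (fun ω => ‖f ω‖ ^ 2) (volume.restrict (Set.Ioi (0:ℝ))) := by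
    by_contra h
    rw [integral_undef h] at hnorm
    exact zero_ne_one hnorm
  have hi2 : Integrable (fun ω => Real.log ω * ‖f ω‖ ^ 2) (volume.restrict (Set.Ioi (0:ℝ))) := by
    refine ⟨Real.measurable_log.aestronglyMeasurable.mul hm2, ?_⟩
    rw [hasFiniteIntegral_iff_norm]
    simpa [abs_mul] using habs
  have hi3 : Integrable (fun ω => ‖f ω‖ ^ 2 - 2 * (Real.log ω * ‖f ω‖ ^ 2))
      (volume.restrict (Set.Ioi (0:ℝ))) := hi1.sub (hi2.const_mul 2)
  have hI : ∫ ω in Set.Ioi (0:ℝ), (‖f ω‖ ^ 2 - 2 * (Real.log ω * ‖f ω‖ ^ 2)) = 1 := by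
    rw [integral_sub hi1 (hi2.const_mul 2), integral_const_mul, hnorm, hmean]; norm_num
  have h1 : ENNReal.ofReal 1 ≤ ∫⁻ ω in Set.Ioi (0:ℝ),
      ENNReal.ofReal (‖f ω‖ ^ 2 - 2 * (Real.log ω * ‖f ω‖ ^ 2)) := by
    rw [← hI, integral_eq_lintegral_pos_part_sub_lintegral_neg_part hi3]
    refine (ENNReal.ofReal_le_ofReal (sub_le_self _ ENNReal.toReal_nonneg)).trans ?_
    exact ENNReal.ofReal_toReal_le
  refine le_trans (ENNReal.ofReal_le_ofReal ?_) (h1.trans ?_)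
  · have : 1 ≤ Real.exp 1 := Real.one_le_exp zero_le_one
    rw [div_le_one (by positivity)]
    nlinarith
  · refine setLIntegral_mono' measurableSet_Ioi fun ω hω => ENNReal.ofReal_le_ofReal ?_
    have hω : 0 < ω := hω
    have h := Real.log_le_sub_one_of_pos (x := (ω ^ 2)⁻¹) (by positivity)
    rw [Real.log_inv, Real.log_pow] at h
    push_cast at h
    rw [div_eq_mul_inv]
    nlinarith [mul_le_mul_of_nonneg_left h (sq_nonneg ‖f ω‖)]
end
end

section
/- Let M > 0 and let f ∈ L²((0,∞)) be absolutely continuous on every compact interval with f(0)=0, ‖f‖_{L²} = 1, ∫₀^∞ ln(ω)|f(ω)|² dω = 0, ∫₀^∞ |f'(ω)|² dω ≤ M, and (∫₀^∞ ω|f'(ω)|² dω)·(∫₀^∞ |f(ω)|²/ω² dω) ≤ M · ∫₀^∞ |f(ω)|²/ω dω. Then ∫₀^∞ ω |f'(ω)|² dω ≤ 2e² M(M+1). -/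
open MeasureTheory Set Filter Topology
open scoped ENNReal Topology

noncomputable section

theorem wdb_aux (M : ℝ) (f g : ℝ → ℂ)
    (hgint : ∀ x : ℝ, IntervalIntegrable g volume 0 x)
    (hfg : ∀ x : ℝ, f x = ∫ t in (0:ℝ)..x, g t)
    (hg : MemLp g 2 (volume.restrict (Set.Ioi (0:ℝ))))
    (hgM : ∫ ω in Set.Ioi (0:ℝ), ‖g ω‖ ^ 2 ≤ M) (x : ℝ) (hx : 0 < x) :
    ‖f x‖ ^ 2 ≤ M * x := by
  have hsq : IntegrableOn (fun t => ‖g t‖ ^ 2) (Ioi 0) volume :=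
    (memLp_two_iff_integrable_sq_norm hg.1).1 hg
  have hsqx : IntegrableOn (fun t => ‖g t‖ ^ 2) (Ioc 0 x) volume :=
    hsq.mono_set Ioc_subset_Ioi_self
  have hle : ∫ t in Ioc 0 x, ‖g t‖ ^ 2 ≤ M :=
    (setIntegral_mono_set hsq (Eventually.of_forall fun t => by positivity)
      (LE.le.eventuallyLE Ioc_subset_Ioi_self)).trans hgM
  have hI : IntegrableOn (fun t => ‖g t‖) (Ioc 0 x) volume :=
    ((intervalIntegrable_iff_integrableOn_Ioc_of_le hx.le).1 (hgint x)).norm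
  have hfI : ‖f x‖ ≤ ∫ t in Ioc 0 x, ‖g t‖ := by
    rw [hfg x, intervalIntegral.integral_of_le hx.le]
    exact norm_integral_le_integral_norm _
  set I := ∫ t in Ioc 0 x, ‖g t‖ with hIdef
  set J := ∫ t in Ioc 0 x, ‖g t‖ ^ 2 with hJdef
  have h0 : 0 ≤ ∫ t in Ioc 0 x, (‖g t‖ - I / x) ^ 2 :=
    integral_nonneg fun t => sq_nonneg _
  have hc : IntegrableOn (fun _ : ℝ => (I / x) ^ 2) (Ioc 0 x) volume := by
    apply integrableOn_const <;> simp
  have h1 : ∫ t in Ioc 0 x, (‖g t‖ - I / x) ^ 2 = J - 2 * (I / x) * I + x * (I / x) ^ 2 := by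
    have : ∀ t, (‖g t‖ - I / x) ^ 2 = (‖g t‖ ^ 2 - 2 * (I / x) * ‖g t‖) + (I / x) ^ 2 := by
      intro t; ring
    simp_rw [this]
    have hd : IntegrableOn (fun t => ‖g t‖ ^ 2 - 2 * (I / x) * ‖g t‖) (Ioc 0 x) volume :=
      hsqx.sub (hI.const_mul _)
    rw [integral_add hd hc, integral_sub hsqx (hI.const_mul _),
      integral_const_mul]
    simp [hx.le, hIdef, hJdef]
  have h2 : J - 2 * (I / x) * I + x * (I / x) ^ 2 = J - I ^ 2 / x := by
    field_simp; ring
  rw [h1, h2] at h0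
  have h3 : I ^ 2 ≤ J * x := by
    rw [← div_le_iff₀ hx]; linarith
  have h4 : ‖f x‖ ^ 2 ≤ I ^ 2 := by gcongr
  nlinarith

/-- Let `M > 0` and let `f ∈ L²((0,∞))` be absolutely continuous on every compact
interval with `f 0 = 0` (encoded by `f x = ∫₀ˣ g` and `f = 0` on `(-∞,0]`),
`‖f‖_{L²} = 1`, zero expected scale `∫₀^∞ ln(ω)|f(ω)|² dω = 0`,
`∫₀^∞ |f'(ω)|² dω ≤ M`, and
`(∫₀^∞ ω|f'(ω)|² dω)·(∫₀^∞ |f(ω)|²/ω² dω) ≤ M·∫₀^∞ |f(ω)|²/ω dω`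
(in the extended sense). Then `∫₀^∞ ω|f'(ω)|² dω ≤ 2e²M(M+1)`. -/
theorem weighted_deriv_bound (M : ℝ) (hM : 0 < M) (f g : ℝ → ℂ)
    (hf : MemLp f 2 (volume : Measure ℝ))
    (hsupp : ∀ x : ℝ, x ≤ 0 → f x = 0)
    (hnorm : ∫ ω in Set.Ioi (0:ℝ), ‖f ω‖ ^ 2 = 1)
    (hgint : ∀ x : ℝ, IntervalIntegrable g volume 0 x)
    (hfg : ∀ x : ℝ, f x = ∫ t in (0:ℝ)..x, g t)
    (hg : MemLp g 2 (volume.restrict (Set.Ioi (0:ℝ))))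
    (hmean_int : IntegrableOn (fun ω : ℝ => Real.log ω * ‖f ω‖ ^ 2) (Set.Ioi 0) volume)
    (hmean : ∫ ω in Set.Ioi (0:ℝ), Real.log ω * ‖f ω‖ ^ 2 = 0)
    (hgM : ∫ ω in Set.Ioi (0:ℝ), ‖g ω‖ ^ 2 ≤ M)
    (hprod : (∫⁻ ω in Set.Ioi (0:ℝ), ENNReal.ofReal (ω * ‖g ω‖ ^ 2)) *
        (∫⁻ ω in Set.Ioi (0:ℝ), ENNReal.ofReal (‖f ω‖ ^ 2 / ω ^ 2))
      ≤ ENNReal.ofReal M * ∫⁻ ω in Set.Ioi (0:ℝ), ENNReal.ofReal (‖f ω‖ ^ 2 / ω)) :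
    ∫⁻ ω in Set.Ioi (0:ℝ), ENNReal.ofReal (ω * ‖g ω‖ ^ 2)
      ≤ ENNReal.ofReal (2 * Real.exp 1 ^ 2 * M * (M + 1)) := by
  have hsq : IntegrableOn (fun t => ‖f t‖ ^ 2) (Ioi 0) volume :=
    ((memLp_two_iff_integrable_sq_norm hf.1).1 hf).integrableOn
  have hfm : AEMeasurable (fun t => ‖f t‖ ^ 2) (volume.restrict (Ioi 0)) := hsq.1.aemeasurable
  have hnorm' : ∫⁻ ω in Ioi (0:ℝ), ENNReal.ofReal (‖f ω‖ ^ 2) = 1 := by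
    rw [← ofReal_integral_eq_lintegral_ofReal hsq (Eventually.of_forall fun t => by positivity),
      hnorm, ENNReal.ofReal_one]
  have hbd := wdb_aux M f g hgint hfg hg hgM
  have hCi : IntegrableOn (fun ω => ‖f ω‖ ^ 2 / ω) (Ioi 0) volume := by
    have hm : AEStronglyMeasurable (fun ω => ‖f ω‖ ^ 2 / ω) (volume.restrict (Ioi 0)) :=
      (hfm.div aemeasurable_id).aestronglyMeasurable
    rw [← Ioc_union_Ioi_eq_Ioi (zero_le_one' ℝ)]
    apply IntegrableOn.union
    · have hc : IntegrableOn (fun _ : ℝ => M) (Ioc 0 1) volume := by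
        apply integrableOn_const <;> simp
      refine Integrable.mono' hc (hm.mono_set Ioc_subset_Ioi_self) ?_
      filter_upwards [ae_restrict_mem measurableSet_Ioc] with x hx
      have := hx.1
      rw [Real.norm_of_nonneg (by positivity), div_le_iff₀ this]
      exact hbd x this
    · have h1 : Ioi (1:ℝ) ⊆ Ioi 0 := Ioi_subset_Ioi zero_le_one
      refine Integrable.mono' (hsq.mono_set h1) (hm.mono_set h1) ?_
      filter_upwards [ae_restrict_mem measurableSet_Ioi] with x hx
      have hx : 1 < x := hx
      rw [Real.norm_of_nonneg (by positivity)]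
      exact div_le_self (by positivity) hx.le
  have hCeq : ENNReal.ofReal (∫ ω in Ioi (0:ℝ), ‖f ω‖ ^ 2 / ω) =
      ∫⁻ ω in Ioi (0:ℝ), ENNReal.ofReal (‖f ω‖ ^ 2 / ω) := by
    apply ofReal_integral_eq_lintegral_ofReal hCi
    filter_upwards [ae_restrict_mem measurableSet_Ioi] with x hx
    have hx : 0 < x := hx
    show 0 ≤ ‖f x‖ ^ 2 / x
    positivity
  have hC1r : 1 ≤ ∫ ω in Ioi (0:ℝ), ‖f ω‖ ^ 2 / ω := by
    have h : ∫ ω in Ioi (0:ℝ), (‖f ω‖ ^ 2 - Real.log ω * ‖f ω‖ ^ 2) = 1 := by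
      rw [integral_sub hsq hmean_int, hnorm, hmean, sub_zero]
    rw [← h]
    refine setIntegral_mono_on (hsq.sub hmean_int) hCi measurableSet_Ioi fun x hx => ?_
    have hx : 0 < x := hx
    have := Real.one_sub_inv_le_log_of_pos hx
    have h2 : 0 ≤ ‖f x‖ ^ 2 := by positivity
    rw [div_eq_mul_inv]
    nlinarith
  set C := ∫⁻ ω in Ioi (0:ℝ), ENNReal.ofReal (‖f ω‖ ^ 2 / ω) with hC
  set B := ∫⁻ ω in Ioi (0:ℝ), ENNReal.ofReal (‖f ω‖ ^ 2 / ω ^ 2) with hB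
  set A := ∫⁻ ω in Ioi (0:ℝ), ENNReal.ofReal (ω * ‖g ω‖ ^ 2) with hA
  have hC1 : 1 ≤ C := by
    rw [← hCeq, ← ENNReal.ofReal_one]; exact ENNReal.ofReal_le_ofReal hC1r
  have hCtop : C ≠ ∞ := by rw [← hCeq]; exact ENNReal.ofReal_ne_top
  have hCm : AEMeasurable (fun ω => ENNReal.ofReal (‖f ω‖ ^ 2 / ω)) (volume.restrict (Ioi 0)) :=
    (hfm.div aemeasurable_id).ennreal_ofReal
  have hBC : C + C ≤ B + 1 := by
    rw [← hnorm', hC, hB, ← lintegral_add_left' hCm, ← lintegral_add_right' _ hfm.ennreal_ofReal]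
    refine setLIntegral_mono_ae' measurableSet_Ioi (Eventually.of_forall fun x hx => ?_)
    have hx : 0 < x := hx
    rw [← ENNReal.ofReal_add (by positivity) (by positivity),
      ← ENNReal.ofReal_add (by positivity) (by positivity)]
    apply ENNReal.ofReal_le_ofReal
    have h : 0 ≤ ‖f x‖ ^ 2 * (1 / x - 1) ^ 2 := by positivity
    have e : ‖f x‖ ^ 2 * (1 / x - 1) ^ 2 =
        ‖f x‖ ^ 2 / x ^ 2 + ‖f x‖ ^ 2 - (‖f x‖ ^ 2 / x + ‖f x‖ ^ 2 / x) := by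
      field_simp; ring
    linarith
  have hCB : C ≤ B := by
    have : C + 1 ≤ B + 1 := (by gcongr : C + 1 ≤ C + C).trans hBC
    exact (ENNReal.add_le_add_iff_right ENNReal.one_ne_top).1 this
  have hAM : A ≤ ENNReal.ofReal M := by
    have : A * C ≤ ENNReal.ofReal M * C := (by gcongr : A * C ≤ A * B).trans hprod
    exact (ENNReal.mul_le_mul_iff_left (by positivity) hCtop).1 this
  refine hAM.trans (ENNReal.ofReal_le_ofReal ?_)
  have he : 1 ≤ Real.exp 1 ^ 2 := one_le_pow₀ (Real.one_le_exp zero_le_one)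
  nlinarith [mul_pos hM hM, mul_le_mul_of_nonneg_right he (by positivity : 0 ≤ M * (M + 1))]
end
end

section
/- Let M > 0 and let (f_n) be a sequence in L²((0,∞)) such that each f_n is absolutely continuous on every compact interval with f_n(0)=0, f_n' ∈ L²((0,∞)) with ∫₀^∞ |f_n'(ω)|² dω ≤ M, and ‖f_n − f‖_{L²} → 0 for some f ∈ L²((0,∞)). Then ∫₀^∞ |f_n(ω) − f(ω)|²/ω dω → 0 as n → ∞. -/
open MeasureTheory Set Filter Topology
open scoped ENNReal Topology

noncomputable section

theorem cs_aux (M : ℝ) (g : ℝ → ℂ)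
    (hgint : ∀ x : ℝ, IntervalIntegrable g volume 0 x)
    (hgn : MemLp g 2 (volume.restrict (Set.Ioi (0:ℝ))))
    (hgM : ∫ ω in Set.Ioi (0:ℝ), ‖g ω‖ ^ 2 ≤ M) (x : ℝ) (hx : 0 < x) :
    ‖∫ t in (0:ℝ)..x, g t‖ ^ 2 ≤ M * x := by
  have hsq : IntegrableOn (fun t => ‖g t‖ ^ 2) (Set.Ioi (0:ℝ)) :=
    (memLp_two_iff_integrable_sq_norm hgn.1).1 hgn
  have hsq' : IntervalIntegrable (fun t => ‖g t‖ ^ 2) volume 0 x := by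
    rw [intervalIntegrable_iff_integrableOn_Ioc_of_le hx.le]
    exact hsq.mono_set Ioc_subset_Ioi_self
  have h1 : ∫ t in (0:ℝ)..x, ‖g t‖ ^ 2 ≤ M := by
    rw [intervalIntegral.integral_of_le hx.le]
    refine le_trans ?_ hgM
    exact setIntegral_mono_set hsq (Eventually.of_forall fun t => by positivity)
      (Ioc_subset_Ioi_self.eventuallyLE)
  have h2 : ‖∫ t in (0:ℝ)..x, g t‖ ≤ ∫ t in (0:ℝ)..x, ‖g t‖ :=
    intervalIntegral.norm_integral_le_integral_norm hx.le
  set I := ∫ t in (0:ℝ)..x, ‖g t‖ with hI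
  have h3 : 0 ≤ ∫ t in (0:ℝ)..x, (‖g t‖ ^ 2 - 2 * (I / x) * ‖g t‖ + (I / x) ^ 2) :=
    intervalIntegral.integral_nonneg hx.le fun t _ => by
      nlinarith [sq_nonneg (‖g t‖ - I / x)]
  have hn := (hgint x).norm
  rw [intervalIntegral.integral_add (hsq'.sub (hn.const_mul _)) (by simp),
    intervalIntegral.integral_sub hsq' (hn.const_mul _),
    intervalIntegral.integral_const_mul, ← hI, intervalIntegral.integral_const] at h3
  have h4 : I ^ 2 ≤ M * x := by
    have e : (∫ t in (0:ℝ)..x, ‖g t‖ ^ 2) - 2 * (I / x) * I + (x - 0) • (I / x) ^ 2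
        = (∫ t in (0:ℝ)..x, ‖g t‖ ^ 2) - I ^ 2 / x := by
      simp only [smul_eq_mul]; field_simp; ring
    rw [e] at h3
    have : I ^ 2 / x ≤ M := by linarith
    rwa [div_le_iff₀ hx] at this
  have := pow_le_pow_left₀ (norm_nonneg _) h2 2
  linarith

theorem bound_aux (M δ : ℝ) (hM : 0 < M) (hδ : 0 < δ) (h : ℝ → ℂ)
    (hh : ∀ᵐ x : ℝ, 0 < x → ‖h x‖ ^ 2 ≤ 4 * M * x) :
    ∫⁻ ω in Set.Ioi (0:ℝ), ENNReal.ofReal (‖h ω‖ ^ 2 / ω) ≤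
      ENNReal.ofReal (4 * M) * ENNReal.ofReal δ
        + ENNReal.ofReal (1 / δ) * eLpNorm h 2 volume ^ 2 := by
  have e2 : eLpNorm h 2 volume ^ 2 = ∫⁻ x, ‖h x‖ₑ ^ 2 := by
    have := eLpNorm_nnreal_pow_eq_lintegral (μ := (volume : Measure ℝ)) (f := h)
      (p := 2) (by norm_num)
    simpa using this
  have key : ∫⁻ ω in Set.Ioi (0:ℝ), ENNReal.ofReal (‖h ω‖ ^ 2 / ω) ≤
      ∫⁻ ω in Set.Ioi (0:ℝ), ((Ioc 0 δ).indicator (fun _ => ENNReal.ofReal (4 * M)) ω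
        + ENNReal.ofReal (1 / δ) * ‖h ω‖ₑ ^ 2) := by
    refine lintegral_mono_ae ?_
    rw [ae_restrict_iff' measurableSet_Ioi]
    filter_upwards [hh] with x hx hx0
    have hx0 : 0 < x := hx0
    by_cases hd : x ≤ δ
    · rw [indicator_of_mem (show x ∈ Ioc 0 δ from ⟨hx0, hd⟩)]
      refine le_trans (ENNReal.ofReal_le_ofReal ?_) le_self_add
      rw [div_le_iff₀ hx0]
      exact hx hx0
    · push Not at hd
      refine le_trans ?_ le_add_self
      rw [← ofReal_norm_eq_enorm, ← ENNReal.ofReal_pow (norm_nonneg _),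
        ← ENNReal.ofReal_mul (by positivity)]
      apply ENNReal.ofReal_le_ofReal
      rw [div_eq_mul_one_div, mul_comm]
      gcongr
  refine key.trans ?_
  rw [lintegral_add_left (measurable_const.indicator measurableSet_Ioc)]
  refine add_le_add ?_ ?_
  · rw [lintegral_indicator_const measurableSet_Ioc]
    gcongr
    refine (Measure.restrict_apply_le _ _).trans ?_
    simp
  · rw [lintegral_const_mul' _ _ ENNReal.ofReal_ne_top, e2]
    gcongr
    exact Measure.restrict_le_self

/-- Let `M > 0` and let `(fₙ)` be a sequence in `L²((0,∞))`, each `fₙ` absolutely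
continuous on every compact interval with `fₙ 0 = 0` (encoded by `fₙ x = ∫₀ˣ gₙ`
and `fₙ = 0` on `(-∞,0]`), with `fₙ' ∈ L²((0,∞))` and `∫₀^∞ |fₙ'(ω)|² dω ≤ M`.
If `‖fₙ − f‖_{L²} → 0` for some `f ∈ L²((0,∞))`, then `fₙ → f` in the
window-space norm: `∫₀^∞ |fₙ(ω) − f(ω)|²/ω dω → 0`. -/
theorem window_norm_convergence (M : ℝ) (hM : 0 < M)
    (f : ℝ → ℂ) (hf : MemLp f 2 (volume : Measure ℝ))
    (hfsupp : ∀ᵐ x : ℝ ∂volume, x ≤ 0 → f x = 0)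
    (fn gn : ℕ → ℝ → ℂ)
    (hfn : ∀ n, MemLp (fn n) 2 (volume : Measure ℝ))
    (hsupp : ∀ n, ∀ x : ℝ, x ≤ 0 → fn n x = 0)
    (hgint : ∀ n, ∀ x : ℝ, IntervalIntegrable (gn n) volume 0 x)
    (hfg : ∀ n, ∀ x : ℝ, fn n x = ∫ t in (0:ℝ)..x, gn n t)
    (hgn : ∀ n, MemLp (gn n) 2 (volume.restrict (Set.Ioi (0:ℝ))))
    (hgM : ∀ n, ∫ ω in Set.Ioi (0:ℝ), ‖gn n ω‖ ^ 2 ≤ M)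
    (hconv : Tendsto (fun n => eLpNorm (fn n - f) 2 (volume : Measure ℝ)) atTop (𝓝 0)) :
    Tendsto (fun n => ∫⁻ ω in Set.Ioi (0:ℝ), ENNReal.ofReal (‖fn n ω - f ω‖ ^ 2 / ω))
      atTop (𝓝 0) := by
  have hfnM : ∀ n, ∀ x : ℝ, 0 < x → ‖fn n x‖ ^ 2 ≤ M * x := fun n x hx => by
    rw [hfg]; exact cs_aux M (gn n) (hgint n) (hgn n) (hgM n) x hx
  have hfM : ∀ᵐ x : ℝ, 0 < x → ‖f x‖ ^ 2 ≤ M * x := by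
    have hm := tendstoInMeasure_of_tendsto_eLpNorm (by norm_num) (fun n => (hfn n).1) hf.1 hconv
    obtain ⟨ns, -, hns⟩ := hm.exists_seq_tendsto_ae
    filter_upwards [hns] with x hx hx0
    exact le_of_tendsto (hx.norm.pow 2) (Eventually.of_forall fun i => hfnM _ x hx0)
  have hdiff : ∀ n, ∀ᵐ x : ℝ, 0 < x → ‖(fn n - f) x‖ ^ 2 ≤ 4 * M * x := fun n => by
    filter_upwards [hfM] with x hx hx0
    have a := hx hx0
    have b := hfnM n x hx0
    have c : ‖(fn n - f) x‖ ≤ ‖fn n x‖ + ‖f x‖ := norm_sub_le _ _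
    have d := pow_le_pow_left₀ (norm_nonneg _) c 2
    nlinarith [sq_nonneg (‖fn n x‖ - ‖f x‖)]
  set e : ℕ → ℝ := fun n => (eLpNorm (fn n - f) 2 (volume : Measure ℝ)).toReal with he
  have hefin : ∀ n, eLpNorm (fn n - f) 2 (volume : Measure ℝ) = ENNReal.ofReal (e n) := fun n =>
    (ENNReal.ofReal_toReal ((hfn n).sub hf).2.ne).symm
  have he0 : ∀ n, 0 ≤ e n := fun n => ENNReal.toReal_nonneg
  have het : Tendsto e atTop (𝓝 0) := by
    have h0 := (ENNReal.tendsto_toReal ENNReal.zero_ne_top).comp hconv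
    rw [ENNReal.toReal_zero] at h0
    exact h0
  have hB : Tendsto (fun n : ℕ => ENNReal.ofReal (4 * M * (e n + 1 / ((n : ℝ) + 1)) + e n))
      atTop (𝓝 0) := by
    have h1 := ((het.add tendsto_one_div_add_atTop_nhds_zero_nat).const_mul (4 * M)).add het
    simpa using ENNReal.tendsto_ofReal h1
  refine tendsto_of_tendsto_of_tendsto_of_le_of_le tendsto_const_nhds hB
    (fun _ => zero_le) (fun n => ?_)
  have hp : (0 : ℝ) < 1 / ((n : ℝ) + 1) := by positivity
  have hen := he0 n
  have hδ : 0 < e n + 1 / ((n : ℝ) + 1) := by linarith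
  refine (bound_aux M _ hM hδ (fn n - f) (hdiff n)).trans ?_
  rw [hefin, ← ENNReal.ofReal_pow hen, ← ENNReal.ofReal_mul (by positivity),
    ← ENNReal.ofReal_mul (by positivity), ← ENNReal.ofReal_add (by positivity) (by positivity)]
  apply ENNReal.ofReal_le_ofReal
  have : 1 / (e n + 1 / ((n : ℝ) + 1)) * e n ^ 2 ≤ e n := by
    rw [one_div_mul_eq_div, div_le_iff₀ hδ]
    nlinarith
  linarith
end
end

section
/- For any M > 0, the set { f ∈ L²((0,∞)) : f absolutely continuous on every compact interval, f' ∈ L²((0,∞)), ∫₀^∞ |f'(ω)|² dω ≤ M, and (∫₀^∞ ω|f'(ω)|² dω)·(∫₀^∞ |f(ω)|²/ω² dω) ≤ M · ∫₀^∞ |f(ω)|²/ω dω } is closed in L²((0,∞)). -/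
open MeasureTheory Set Filter Topology
open scoped ENNReal Topology

noncomputable section

/-- Sequential weak compactness of balls in a separable Hilbert space. -/
lemma aux_weak_seq {E : Type*} [NormedAddCommGroup E] [InnerProductSpace ℂ E] [CompleteSpace E]
    [TopologicalSpace.SeparableSpace E] (u : ℕ → E) (R : ℝ) (hu : ∀ n, ‖u n‖ ≤ R) :
    ∃ g : E, ‖g‖ ≤ R ∧ ∃ φ : ℕ → ℕ, StrictMono φ ∧
      ∀ h : E, Tendsto (fun n => inner ℂ h (u (φ n))) atTop (𝓝 (inner ℂ h g)) := by
  have hc := WeakDual.isSeqCompact_closedBall ℂ E (0 : StrongDual ℂ E) R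
  obtain ⟨ψ, hψ, φ, hφ, hlim⟩ := hc (x := fun n => StrongDual.toWeakDual
    (InnerProductSpace.toDual ℂ E (u n))) (by
      intro n
      simpa using hu n)
  refine ⟨(InnerProductSpace.toDual ℂ E).symm (WeakDual.toStrongDual ψ), ?_, φ, hφ, ?_⟩
  · simpa using hψ
  · intro h
    have h1 : Tendsto (fun n => inner ℂ (u (φ n)) h) atTop
        (𝓝 (inner ℂ ((InnerProductSpace.toDual ℂ E).symm (WeakDual.toStrongDual ψ)) h)) := by
      have := (WeakBilin.tendsto_iff_forall_eval_tendsto _ 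
        (ContinuousLinearMap.coe_injective) (𝕜 := ℂ)).1 hlim h
      simpa using! this
    have h2 := (Complex.continuous_conj.tendsto _).comp h1
    simpa only [Function.comp_def, inner_conj_symm] using h2

lemma aux_norm_sq_s16 (G : Lp ℂ 2 (volume.restrict (Set.Ioi (0:ℝ)))) :
    ∫ ω in Set.Ioi (0:ℝ), ‖G ω‖ ^ 2 = ‖G‖ ^ 2 := by
  have h := L2.inner_def (𝕜 := ℂ) G G
  rw [inner_self_eq_norm_sq_to_K] at h
  simp_rw [inner_self_eq_norm_sq_to_K] at h
  have h3 : ((‖G‖ ^ 2 : ℝ) : ℂ) = ((∫ ω in Set.Ioi (0:ℝ), ‖G ω‖ ^ 2 : ℝ) : ℂ) := by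
    rw [← integral_complex_ofReal]
    simpa using h
  exact (Complex.ofReal_injective h3).symm

/-- Lebesgue measure on the positive half-line. -/
abbrev muP : Measure ℝ := volume.restrict (Set.Ioi (0:ℝ))

lemma aux_A_lsc_K (G : Lp ℂ 2 (volume.restrict (Set.Ioi (0:ℝ))))
    (u : ℕ → Lp ℂ 2 (volume.restrict (Set.Ioi (0:ℝ))))
    (h : ∀ k, Tendsto (fun n => inner ℂ k (u n)) atTop (𝓝 (inner ℂ k G))) (K : ℕ) :
    ∫⁻ ω in Set.Ioi (0:ℝ), (Set.Iio (K : ℝ)).indicator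
        (fun ω => ENNReal.ofReal (ω * ‖G ω‖ ^ 2)) ω ≤
      liminf (fun n => ∫⁻ ω in Set.Ioi (0:ℝ), ENNReal.ofReal (ω * ‖u n ω‖ ^ 2)) atTop := by
  -- weight
  set w : ℝ → ℝ := (Set.Ioo (0:ℝ) K).indicator (fun ω => ω) with hw
  have hw0 : ∀ x, 0 ≤ w x := fun x => Set.indicator_nonneg (fun y hy => hy.1.le) x
  have hwK : ∀ x, w x ≤ K := by
    intro x
    by_cases hx : x ∈ Set.Ioo (0:ℝ) K
    · simp [hw, hx, hx.2.le]
    · simp [hw, hx]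
  have hwle : ∀ x, 0 < x → w x ≤ x := by
    intro x hx0
    by_cases hx : x ∈ Set.Ioo (0:ℝ) K
    · simp [hw, hx]
    · simp [hw, hx, hx0.le]
  have hwm : Measurable w := measurable_id.indicator measurableSet_Ioo
  have hk : MemLp (fun ω => (w ω : ℂ) * G ω) 2 muP := by
    refine MemLp.of_le_mul (c := K) (Lp.memLp G) ?_ ?_
    · exact (Complex.measurable_ofReal.comp hwm).aestronglyMeasurable.mul (Lp.aestronglyMeasurable G)
    · refine ae_of_all _ fun x => ?_
      rw [norm_mul, Complex.norm_real, Real.norm_of_nonneg (hw0 x)]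
      exact mul_le_mul_of_nonneg_right (hwK x) (norm_nonneg _)
  set k := hk.toLp with hkdef
  have hkae : ∀ v : Lp ℂ 2 muP, (inner ℂ k v).re = ∫ x, w x * (inner ℂ (G x) (v x)).re ∂muP := by
    intro v
    rw [L2.inner_def]
    have := integral_re (𝕜 := ℂ) (L2.integrable_inner (𝕜 := ℂ) k v)
    simp only [RCLike.re_eq_complex_re] at this
    rw [← this]
    refine integral_congr_ae ?_
    filter_upwards [hk.coeFn_toLp] with x hx
    rw [hkdef, hx]
    simp
    ring
  have hint : ∀ v : Lp ℂ 2 muP, Integrable (fun x => w x * (inner ℂ (G x) (v x)).re) muP := by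
    intro v
    have h1 := (L2.integrable_inner (𝕜 := ℂ) G v).re
    refine (h1.bdd_mul (c := K) hwm.aestronglyMeasurable (ae_of_all _ fun x => ?_))
    rw [Real.norm_of_nonneg (hw0 x)]; exact hwK x
  have hself : ∀ v : Lp ℂ 2 muP, Integrable (fun x => w x * ‖v x‖ ^ 2) muP := by
    intro v
    have h1 := (L2.integrable_inner (𝕜 := ℂ) v v).re
    have h2 := (h1.bdd_mul (c := K) hwm.aestronglyMeasurable (ae_of_all _ fun x => (by
      rw [Real.norm_of_nonneg (hw0 x)]; exact hwK x)))
    refine h2.congr (ae_of_all _ fun x => ?_)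
    simp only [inner_self_eq_norm_sq]
  have hGG : (inner ℂ k G).re = ∫ x, w x * ‖G x‖ ^ 2 ∂muP := by
    rw [hkae]
    refine integral_congr_ae (ae_of_all _ fun x => ?_)
    have := inner_self_eq_norm_sq (𝕜 := ℂ) (G x)
    simp only [RCLike.re_eq_complex_re] at this
    simp only [this]
  have hbound : ∀ n, ENNReal.ofReal (2 * (inner ℂ k (u n)).re - (inner ℂ k G).re) ≤
      ∫⁻ ω, ENNReal.ofReal (ω * ‖u n ω‖ ^ 2) ∂muP := by
    intro n
    have h1 : 2 * (inner ℂ k (u n)).re - (inner ℂ k G).re ≤ ∫ x, w x * ‖u n x‖ ^ 2 ∂muP := by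
      rw [hGG, hkae, ← integral_const_mul, ← integral_sub ((hint _).const_mul 2) (hself G)]
      refine integral_mono (((hint _).const_mul 2).sub (hself G)) (hself _) fun x => ?_
      have h2 : 2 * (inner ℂ (G x) (u n x)).re ≤ ‖G x‖ ^ 2 + ‖u n x‖ ^ 2 := by
        have h3 : (inner ℂ (G x) (u n x)).re ≤ ‖G x‖ * ‖u n x‖ :=
          (Complex.re_le_norm _).trans (norm_inner_le_norm _ _)
        nlinarith [sq_nonneg (‖G x‖ - ‖u n x‖)]
      simp only
      nlinarith [mul_le_mul_of_nonneg_left h2 (hw0 x)]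
    refine (ENNReal.ofReal_le_ofReal h1).trans ?_
    rw [ofReal_integral_eq_lintegral_ofReal (hself _)
      (ae_of_all _ fun x => mul_nonneg (hw0 x) (sq_nonneg _))]
    refine setLIntegral_mono' measurableSet_Ioi fun x hx => ?_
    exact ENNReal.ofReal_le_ofReal (mul_le_mul_of_nonneg_right (hwle x hx) (sq_nonneg _))
  have hlhs : ∫⁻ ω, (Set.Iio (K : ℝ)).indicator
        (fun ω => ENNReal.ofReal (ω * ‖G ω‖ ^ 2)) ω ∂muP = ENNReal.ofReal (inner ℂ k G).re := by
    rw [hGG, ofReal_integral_eq_lintegral_ofReal (hself _)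
      (ae_of_all _ fun x => mul_nonneg (hw0 x) (sq_nonneg _))]
    refine setLIntegral_congr_fun measurableSet_Ioi fun x hx => ?_
    by_cases hxK : x < K
    · simp [hw, hxK, mem_Ioi.1 hx]
    · simp [hw, hxK]
  rw [hlhs]
  have hre := (Complex.continuous_re.tendsto _).comp (h k)
  have hT : Tendsto (fun n => ENNReal.ofReal (2 * (inner ℂ k (u n)).re - (inner ℂ k G).re)) atTop
      (𝓝 (ENNReal.ofReal (inner ℂ k G).re)) := by
    have : (inner ℂ k G).re = 2 * (inner ℂ k G).re - (inner ℂ k G).re := by ring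
    rw [this]
    conv => 
      congr
      · ext n
        rw [← this]
    exact (ENNReal.continuous_ofReal.tendsto _).comp ((hre.const_mul 2).sub_const _)
  rw [← hT.liminf_eq]
  exact liminf_le_liminf (Eventually.of_forall hbound)

lemma aux_A_lsc (G : Lp ℂ 2 (volume.restrict (Set.Ioi (0:ℝ))))
    (u : ℕ → Lp ℂ 2 (volume.restrict (Set.Ioi (0:ℝ))))
    (h : ∀ k, Tendsto (fun n => inner ℂ k (u n)) atTop (𝓝 (inner ℂ k G))) :
    ∫⁻ ω in Set.Ioi (0:ℝ), ENNReal.ofReal (ω * ‖G ω‖ ^ 2) ≤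
      liminf (fun n => ∫⁻ ω in Set.Ioi (0:ℝ), ENNReal.ofReal (ω * ‖u n ω‖ ^ 2)) atTop := by
  have hsup : ∀ ω, ENNReal.ofReal (ω * ‖G ω‖ ^ 2) = ⨆ K : ℕ, (Set.Iio (K : ℝ)).indicator
        (fun ω => ENNReal.ofReal (ω * ‖G ω‖ ^ 2)) ω := by
    intro ω
    refine le_antisymm ?_ (iSup_le fun K => Set.indicator_le_self _ _ _)
    obtain ⟨K, hK⟩ := exists_nat_gt ω
    refine le_iSup_of_le K ?_
    rw [Set.indicator_of_mem (by exact hK)]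
  rw [lintegral_congr hsup, lintegral_iSup']
  · exact iSup_le fun K => aux_A_lsc_K G u h K
  · intro K
    refine AEMeasurable.indicator ?_ measurableSet_Iio
    exact (measurable_id.aemeasurable.mul
      ((Lp.aestronglyMeasurable G).norm.aemeasurable.pow_const 2)).ennreal_ofReal
  · refine ae_of_all _ fun x => ?_
    intro K L hKL
    refine Set.indicator_le_indicator_of_subset ?_ (fun _ => zero_le) x
    exact Set.Iio_subset_Iio (by exact_mod_cast hKL)

lemma aux_inner_prim (G : Lp ℂ 2 muP) (x : ℝ) (hfin : muP (Set.Ioc 0 x) ≠ ∞) :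
    inner ℂ (indicatorConstLp 2 (measurableSet_Ioc (a := (0:ℝ)) (b := x)) hfin (1:ℂ)) G =
      ∫ t in Set.Ioc 0 x, G t := by
  rw [L2.inner_indicatorConstLp_one, Measure.restrict_restrict measurableSet_Ioc,
    Set.inter_eq_self_of_subset_left Set.Ioc_subset_Ioi_self]

lemma aux_fin (x : ℝ) : muP (Set.Ioc 0 x) ≠ ∞ :=
  ((Measure.restrict_apply_le _ _).trans_lt (by simp)).ne

lemma aux_prim_bound (G : Lp ℂ 2 muP) (M : ℝ) (hG : ‖G‖ ^ 2 ≤ M) (x : ℝ) (hx : 0 < x) :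
    ‖∫ t in Set.Ioc 0 x, G t‖ ^ 2 ≤ M * x := by
  rw [← aux_inner_prim G x (aux_fin x)]
  have h1 := norm_inner_le_norm (𝕜 := ℂ)
    (indicatorConstLp 2 (measurableSet_Ioc (a := (0:ℝ)) (b := x)) (aux_fin x) (1:ℂ)) G
  have h2 : ‖indicatorConstLp 2 (measurableSet_Ioc (a := (0:ℝ)) (b := x)) (aux_fin x) (1:ℂ)‖ ^ 2
      = x := by
    rw [norm_indicatorConstLp (by simp) (by simp), measureReal_def,
      Measure.restrict_apply measurableSet_Ioc,
      Set.inter_eq_self_of_subset_left Set.Ioc_subset_Ioi_self]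
    simp only [Real.volume_Ioc, sub_zero, norm_one, one_mul, ENNReal.toReal_ofReal hx.le,
      ENNReal.toReal_ofNat]
    rw [← Real.sqrt_eq_rpow, Real.sq_sqrt hx.le]
  calc _ ≤ _ := pow_le_pow_left₀ (norm_nonneg _) h1 2
    _ = x * ‖G‖ ^ 2 := by rw [mul_pow, h2]
    _ ≤ M * x := by nlinarith

lemma aux_C_bound (p q : ℝ → ℂ) (hq : AEMeasurable q muP) (M ε : ℝ) (hM : 0 < M)
    (hε : 0 < ε) (hp : ∀ x, 0 < x → ‖p x‖ ^ 2 ≤ M * x) :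
    ∫⁻ ω, ENNReal.ofReal (‖p ω‖ ^ 2 / ω) ∂muP ≤
      ENNReal.ofReal M * ENNReal.ofReal ε
        + ENNReal.ofReal (1 + ε) * (∫⁻ ω, ENNReal.ofReal (‖q ω‖ ^ 2 / ω) ∂muP)
        + ENNReal.ofReal ((1 + 1 / ε) / ε) * ∫⁻ ω, ENNReal.ofReal (‖p ω - q ω‖ ^ 2) ∂muP := by
  have hm : ∫⁻ ω, (Set.Ioc 0 ε).indicator (fun _ => ENNReal.ofReal M) ω ∂muP
      = ENNReal.ofReal M * ENNReal.ofReal ε := by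
    rw [lintegral_indicator measurableSet_Ioc, Measure.restrict_restrict measurableSet_Ioc,
      Set.inter_eq_self_of_subset_left Set.Ioc_subset_Ioi_self]
    simp
  have hqm : AEMeasurable (fun ω => ENNReal.ofReal (‖q ω‖ ^ 2 / ω)) muP :=
    ((hq.norm.pow_const 2).div measurable_id.aemeasurable).ennreal_ofReal
  rw [← hm, ← lintegral_const_mul'' _ hqm, ← lintegral_const_mul' _ _ ENNReal.ofReal_ne_top,
    ← lintegral_add_left' (by fun_prop (disch := measurability)), ← lintegral_add_left' (show AEMeasurable (fun x =>
      (Set.Ioc 0 ε).indicator (fun _ => ENNReal.ofReal M) x +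
        ENNReal.ofReal (1 + ε) * ENNReal.ofReal (‖q x‖ ^ 2 / x)) muP from
      ((measurable_const.indicator measurableSet_Ioc).aemeasurable).add (hqm.const_mul _))]
  refine setLIntegral_mono' measurableSet_Ioi fun x hx => ?_
  have hx : 0 < x := hx
  by_cases hxe : x ≤ ε
  · rw [Set.indicator_of_mem (show x ∈ Set.Ioc 0 ε from ⟨hx, hxe⟩), add_assoc]
    refine le_add_right (ENNReal.ofReal_le_ofReal ?_)
    rw [div_le_iff₀ hx]
    exact hp x hx
  · rw [Set.indicator_of_notMem (show x ∉ Set.Ioc 0 ε from fun h => hxe h.2), zero_add, ← ENNReal.ofReal_mul (by positivity),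
      ← ENNReal.ofReal_mul (by positivity), ← ENNReal.ofReal_add (by positivity) (by positivity)]
    refine ENNReal.ofReal_le_ofReal ?_
    push Not at hxe
    have h1 : ‖p x‖ ≤ ‖q x‖ + ‖p x - q x‖ := by
      calc ‖p x‖ = ‖q x + (p x - q x)‖ := by congr 1; ring
        _ ≤ _ := norm_add_le _ _
    set a := ‖q x‖
    set b := ‖p x - q x‖
    have ha : 0 ≤ a := norm_nonneg _
    have hb : 0 ≤ b := norm_nonneg _
    have h2 : ‖p x‖ ^ 2 ≤ (1 + ε) * a ^ 2 + (1 + 1 / ε) * b ^ 2 := by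
      have h3 : ‖p x‖ ^ 2 ≤ (a + b) ^ 2 := pow_le_pow_left₀ (norm_nonneg _) h1 2
      have h4 : (1 + ε) * a ^ 2 + (1 + 1 / ε) * b ^ 2 - (a + b) ^ 2 = (ε * a - b) ^ 2 / ε := by
        field_simp
        ring
      have h5 : 0 ≤ (ε * a - b) ^ 2 / ε := by positivity
      linarith
    calc ‖p x‖ ^ 2 / x ≤ ((1 + ε) * a ^ 2 + (1 + 1 / ε) * b ^ 2) / x := by gcongr
      _ = (1 + ε) * (a ^ 2 / x) + (1 + 1 / ε) / x * b ^ 2 := by ring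
      _ ≤ _ := by gcongr

/-- Closedness from sequences: the final limiting inequality. -/
lemma aux_limit (A B c : ℝ≥0∞) (M : ℝ) 
    (h : ∀ ε : ℝ, 0 < ε → A * B ≤ ENNReal.ofReal M * (ENNReal.ofReal M * ENNReal.ofReal ε
        + ENNReal.ofReal (1 + ε) * c)) (hM : 0 < M) : A * B ≤ ENNReal.ofReal M * c := by
  by_cases hc : c = ∞
  · rw [hc, ENNReal.mul_top (by simpa using hM)]; exact le_top
  have hT : Tendsto (fun ε : ℝ => ENNReal.ofReal M * (ENNReal.ofReal M * ENNReal.ofReal ε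
        + ENNReal.ofReal (1 + ε) * c)) (𝓝[>] 0) (𝓝 (ENNReal.ofReal M *
          (ENNReal.ofReal M * ENNReal.ofReal 0 + ENNReal.ofReal (1 + 0) * c))) := by
    refine Tendsto.mono_left ?_ nhdsWithin_le_nhds
    refine ENNReal.Tendsto.const_mul (Tendsto.add ?_ ?_) (Or.inr ENNReal.ofReal_ne_top)
    · exact ENNReal.Tendsto.const_mul (ENNReal.continuous_ofReal.tendsto _)
        (Or.inr ENNReal.ofReal_ne_top)
    · exact ENNReal.Tendsto.mul_const ((ENNReal.continuous_ofReal.comp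
        (continuous_const.add continuous_id)).tendsto 0) (Or.inr hc)
  have := ge_of_tendsto hT (eventually_nhdsWithin_of_forall fun ε hε => h ε hε)
  simpa using this

lemma aux_L2_tendsto (u : ℕ → Lp ℂ 2 (volume : Measure ℝ)) (F : Lp ℂ 2 (volume : Measure ℝ))
    (h : Tendsto u atTop (𝓝 F)) :
    Tendsto (fun n => ∫⁻ ω, ENNReal.ofReal (‖u n ω - F ω‖ ^ 2) ∂muP) atTop (𝓝 0) := by
  have h1 := (Lp.tendsto_Lp_iff_tendsto_eLpNorm' u F).1 h
  have h2 : Tendsto (fun n => eLpNorm (⇑(u n) - ⇑F) 2 volume ^ 2) atTop (𝓝 0) := by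
    simpa [Function.comp_def] using ((ENNReal.continuous_pow 2).tendsto _).comp h1
  refine tendsto_of_tendsto_of_tendsto_of_le_of_le tendsto_const_nhds h2 (fun _ => zero_le) ?_
  intro n
  refine (lintegral_mono' Measure.restrict_le_self le_rfl).trans (le_of_eq ?_)
  have := eLpNorm_nnreal_pow_eq_lintegral (p := 2) (μ := (volume : Measure ℝ))
    (f := ⇑(u n) - ⇑F) (by simp)
  have h3 : eLpNorm (⇑(u n) - ⇑F) 2 volume ^ 2 = ∫⁻ x, ‖(⇑(u n) - ⇑F) x‖ₑ ^ 2 := by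
    have h4 : ((2 : NNReal) : ℝ) = ((2 : ℕ) : ℝ) := by simp
    simp only [h4, ENNReal.rpow_natCast] at this
    exact this
  simp only [h3]
  refine lintegral_congr fun x => ?_
  rw [ENNReal.ofReal_pow (norm_nonneg _), ofReal_norm, Pi.sub_apply]

theorem isClosed_phase_product_set (M : ℝ) (hM : 0 < M) :
    IsClosed {F : Lp ℂ 2 (volume : Measure ℝ) |
      ∃ f g : ℝ → ℂ, (⇑F =ᵐ[volume] f) ∧
        (∀ x : ℝ, x ≤ 0 → f x = 0) ∧
        (∀ x : ℝ, IntervalIntegrable g volume 0 x) ∧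
        (∀ x : ℝ, f x = ∫ t in (0:ℝ)..x, g t) ∧
        MemLp g 2 (volume.restrict (Set.Ioi (0:ℝ))) ∧
        (∫ ω in Set.Ioi (0:ℝ), ‖g ω‖ ^ 2 ≤ M) ∧
        ((∫⁻ ω in Set.Ioi (0:ℝ), ENNReal.ofReal (ω * ‖g ω‖ ^ 2)) *
            (∫⁻ ω in Set.Ioi (0:ℝ), ENNReal.ofReal (‖f ω‖ ^ 2 / ω ^ 2))
          ≤ ENNReal.ofReal M *
            ∫⁻ ω in Set.Ioi (0:ℝ), ENNReal.ofReal (‖f ω‖ ^ 2 / ω))} := by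
  have : Fact ((2 : ℝ≥0∞) ≠ ∞) := ⟨by simp⟩
  refine IsSeqClosed.isClosed ?_
  intro u F hu hlim
  simp only [Set.mem_ofPred_eq] at hu
  choose f g hFf hf0 hgi hfg hgm hgM hprod using hu
  set G : ℕ → Lp ℂ 2 muP := fun n => (hgm n).toLp (g n) with hG
  have hGae : ∀ n, ∀ᵐ x ∂muP, G n x = g n x := fun n => (hgm n).coeFn_toLp
  have hGsq : ∀ n, ‖G n‖ ^ 2 ≤ M := by
    intro n
    rw [← aux_norm_sq_s16]
    refine le_trans (le_of_eq (integral_congr_ae ?_)) (hgM n)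
    filter_upwards [hGae n] with x hx
    rw [hx]
  have hGn : ∀ n, ‖G n‖ ≤ Real.sqrt M := fun n => Real.le_sqrt_of_sq_le (hGsq n)
  have hfP : ∀ n x, 0 < x → f n x = ∫ t in Set.Ioc 0 x, G n t := by
    intro n x hx
    rw [hfg n x, intervalIntegral.integral_of_le hx.le]
    refine integral_congr_ae ?_
    have := ae_restrict_of_ae_restrict_of_subset (Set.Ioc_subset_Ioi_self : Set.Ioc 0 x ⊆ _)
      (hGae n)
    filter_upwards [this] with t ht
    exact ht.symm
  -- subsequences
  obtain ⟨φ, hφ, hae⟩ := (tendstoInMeasure_of_tendsto_Lp hlim).exists_seq_tendsto_ae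
  obtain ⟨G0, hG0, ψ, hψ, hweak⟩ := aux_weak_seq (fun n => G (φ n)) (Real.sqrt M)
    (fun n => hGn _)
  have hG0sq : ‖G0‖ ^ 2 ≤ M := by
    calc _ ≤ (Real.sqrt M) ^ 2 := pow_le_pow_left₀ (norm_nonneg _) hG0 2
      _ = M := Real.sq_sqrt hM.le
  set g0 : ℝ → ℂ := (Set.Ioi (0:ℝ)).indicator G0 with hg0
  set f0 : ℝ → ℂ := fun x => ∫ t in (0:ℝ)..x, g0 t with hf0def
  have hg0ae : ∀ᵐ x ∂muP, g0 x = G0 x := by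
    refine (ae_restrict_iff' measurableSet_Ioi).2 (ae_of_all _ fun x hx => ?_)
    exact Set.indicator_of_mem hx _
  have hg0L : MemLp g0 2 muP := (memLp_congr_ae hg0ae).2 (Lp.memLp G0)
  have hf0P : ∀ x, 0 < x → f0 x = ∫ t in Set.Ioc 0 x, G0 t := by
    intro x hx
    simp only [hf0def]
    rw [intervalIntegral.integral_of_le hx.le]
    exact integral_congr_ae (ae_restrict_of_ae_restrict_of_subset Set.Ioc_subset_Ioi_self hg0ae)
  have hf0neg : ∀ x, x ≤ 0 → f0 x = 0 := by
    intro x hx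
    simp only [hf0def]
    rw [intervalIntegral.integral_of_ge hx, neg_eq_zero]
    refine setIntegral_eq_zero_of_forall_eq_zero fun t ht => ?_
    exact Set.indicator_of_notMem (not_lt.2 ht.2) _
  have hg0glob : MemLp g0 2 volume := by
    rw [hg0, memLp_indicator_iff_restrict measurableSet_Ioi]
    exact Lp.memLp G0
  have hg0i : ∀ x : ℝ, IntervalIntegrable g0 volume 0 x := by
    intro x
    rw [intervalIntegrable_iff]
    have : IsFiniteMeasure (volume.restrict (Set.uIoc 0 x)) := ⟨by simp [Set.uIoc]⟩
    exact (hg0glob.restrict _).integrable (by norm_num)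
  have hpt : ∀ x, Tendsto (fun n => f (φ (ψ n)) x) atTop (𝓝 (f0 x)) := by
    intro x
    rcases le_or_gt x 0 with hx | hx
    · simp only [hf0neg x hx, hf0 _ x hx]
      exact tendsto_const_nhds
    · have := hweak (indicatorConstLp 2 (measurableSet_Ioc (a := (0:ℝ)) (b := x)) (aux_fin x) (1:ℂ))
      simp only [aux_inner_prim] at this
      simpa only [hf0P x hx, hfP _ x hx] using this
  have hFf0 : ⇑F =ᵐ[volume] f0 := by
    have h1 : ∀ᵐ x, ∀ n, u n x = f n x := ae_all_iff.2 hFf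
    filter_upwards [hae, h1] with x hx h1x
    have h2 := hx.comp hψ.tendsto_atTop
    simp only [Function.comp_def, h1x] at h2
    exact tendsto_nhds_unique h2 (hpt x)
  have hf0c : AEMeasurable f0 muP :=
    ((Lp.aestronglyMeasurable F).aemeasurable.congr hFf0).restrict
  have hfm : ∀ n, AEMeasurable (f n) muP := fun n =>
    ((Lp.aestronglyMeasurable (u n)).aemeasurable.congr (hFf n)).restrict
  refine ⟨f0, g0, hFf0, hf0neg, hg0i, fun x => rfl, hg0L, ?_, ?_⟩
  · refine le_trans (le_of_eq ?_) hG0sq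
    rw [← aux_norm_sq_s16]
    refine integral_congr_ae ?_
    filter_upwards [hg0ae] with x hx
    rw [hx]
  set A : ℕ → ℝ≥0∞ := fun n => ∫⁻ ω, ENNReal.ofReal (ω * ‖g (φ (ψ n)) ω‖ ^ 2) ∂muP with hA
  set B : ℕ → ℝ≥0∞ := fun n => ∫⁻ ω, ENNReal.ofReal (‖f (φ (ψ n)) ω‖ ^ 2 / ω ^ 2) ∂muP with hB
  have hAl : ∫⁻ ω, ENNReal.ofReal (ω * ‖g0 ω‖ ^ 2) ∂muP ≤ liminf A atTop := by
    have h1 := aux_A_lsc G0 (fun n => G (φ (ψ n))) hweak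
    have h2 : ∫⁻ ω, ENNReal.ofReal (ω * ‖g0 ω‖ ^ 2) ∂muP =
        ∫⁻ ω, ENNReal.ofReal (ω * ‖G0 ω‖ ^ 2) ∂muP := by
      refine lintegral_congr_ae ?_
      filter_upwards [hg0ae] with x hx
      rw [hx]
    have h3 : A = fun n => ∫⁻ ω, ENNReal.ofReal (ω * ‖G (φ (ψ n)) ω‖ ^ 2) ∂muP := by
      funext n
      refine lintegral_congr_ae ?_
      filter_upwards [hGae (φ (ψ n))] with x hx
      rw [hx]
    rw [h2, h3]
    exact h1
  have hBl : ∫⁻ ω, ENNReal.ofReal (‖f0 ω‖ ^ 2 / ω ^ 2) ∂muP ≤ liminf B atTop := by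
    refine le_trans (le_of_eq ?_) (lintegral_liminf_le' fun n =>
      (((hfm _).norm.pow_const 2).div (measurable_id.pow_const 2).aemeasurable).ennreal_ofReal)
    refine lintegral_congr fun x => ?_
    refine (Tendsto.liminf_eq ?_).symm
    exact (ENNReal.continuous_ofReal.tendsto _).comp ((((hpt x).norm).pow 2).div_const _)
  refine aux_limit _ _ _ M (fun ε hε => ?_) hM
  refine (mul_le_mul' hAl hBl).trans (ENNReal.le_liminf_mul.trans ?_)
  have hD : Tendsto (fun n => ∫⁻ ω, ENNReal.ofReal (‖f (φ (ψ n)) ω - f0 ω‖ ^ 2) ∂muP)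
      atTop (𝓝 0) := by
    have h1 := aux_L2_tendsto _ F (hlim.comp (hφ.comp hψ).tendsto_atTop)
    refine h1.congr fun n => lintegral_congr_ae ?_
    filter_upwards [ae_restrict_of_ae (hFf (φ (ψ n))), ae_restrict_of_ae hFf0] with x h1 h2
    simp only [Function.comp_apply]
    rw [h1, h2]
  have hR : Tendsto (fun n => ENNReal.ofReal M * (ENNReal.ofReal M * ENNReal.ofReal ε
        + ENNReal.ofReal (1 + ε) * (∫⁻ ω, ENNReal.ofReal (‖f0 ω‖ ^ 2 / ω) ∂muP)
        + ENNReal.ofReal ((1 + 1 / ε) / ε) *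
          ∫⁻ ω, ENNReal.ofReal (‖f (φ (ψ n)) ω - f0 ω‖ ^ 2) ∂muP)) atTop
      (𝓝 (ENNReal.ofReal M * (ENNReal.ofReal M * ENNReal.ofReal ε
        + ENNReal.ofReal (1 + ε) * (∫⁻ ω, ENNReal.ofReal (‖f0 ω‖ ^ 2 / ω) ∂muP)
        + ENNReal.ofReal ((1 + 1 / ε) / ε) * 0))) :=
    ENNReal.Tendsto.const_mul (tendsto_const_nhds.add
      (ENNReal.Tendsto.const_mul hD (Or.inr ENNReal.ofReal_ne_top)))
      (Or.inr ENNReal.ofReal_ne_top)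
  rw [mul_zero, add_zero] at hR
  rw [← hR.liminf_eq]
  refine liminf_le_liminf (Eventually.of_forall fun n => ?_)
  refine (hprod (φ (ψ n))).trans (mul_le_mul_right ?_ _)
  refine aux_C_bound _ _ hf0c M ε hM hε fun x hx => ?_
  rw [hfP _ x hx]
  exact aux_prim_bound _ M (hGsq _) x hx
end
end
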